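/- There is a constant c > 0 such that for all signs s₁, s₂, s₃ ∈ {+1,−1} and all scalar Schwartz functions ψ, ψ′, φ₀ on ℝ×ℝ², the angle-weighted convolution estimate ∫∫∫∫ ∠(s₁η, s₂(η−ξ)) |ψ̃(λ,η)| |ψ̃′(λ−τ, η−ξ)| |φ̃₀(τ,ξ)| dλ dη dτ dξ ≤ c ‖ψ‖_{X^{0,1/3,1}_{s₁}} ‖ψ′‖_{X^{0,1/3,1}_{s₂}} ‖φ₀‖_{X^{1/2,1/3,1}_{s₃}} holds, where the integral extends over (λ,η,τ,ξ) ∈ ℝ×ℝ²×ℝ×ℝ² and the angle is interpreted as 0 if one of the two vectors vanishes. -/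

import Mathlib

open MeasureTheory Complex
open scoped RealInnerProductSpace

noncomputable section

attribute [local instance] Classical.propDecidable

/-- ℝ² with the Euclidean norm. -/
abbrev E2 : Type := EuclideanSpace ℝ (Fin 2)

/-- Space-time ℝ × ℝ². -/
abbrev SpaceTime : Type := ℝ × E2

/-- Space–time Fourier transform f̃(τ,ξ). -/
def ftST (f : SpaceTime → ℂ) (τ : ℝ) (ξ : E2) : ℂ :=
  ∫ p : SpaceTime, Complex.exp (-Complex.I * ((p.1 * τ + ⟪p.2, ξ⟫ : ℝ) : ℂ)) * f p

/-- Spatial Fourier transform. -/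
def ftX (f : E2 → ℂ) (ξ : E2) : ℂ :=
  ∫ x : E2, Complex.exp (-Complex.I * ((⟪x, ξ⟫ : ℝ) : ℂ)) * f x

/-- Japanese bracket ⟨x⟩ = (1+x²)^{1/2}. -/
def jap (x : ℝ) : ℝ := Real.sqrt (1 + x ^ 2)

/-- L² norm in the Fourier variables (τ,ξ). -/
def l2F (g : ℝ → E2 → ℂ) : ℝ := Real.sqrt (∫ τ : ℝ, ∫ ξ : E2, ‖g τ ξ‖ ^ 2)

/-- Classical wave-Bourgain norm ‖f‖_{X^{a,b}_s}. -/
def Xnorm (a b s : ℝ) (f : SpaceTime → ℂ) : ℝ :=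
  l2F fun τ ξ => ((jap ‖ξ‖ ^ a * jap (τ + s * ‖ξ‖) ^ b : ℝ) : ℂ) * ftST f τ ξ

/-- The hypotheses on the Littlewood–Paley bump function φ. -/
structure IsLPBump (φ : ℝ → ℝ) : Prop where
  smooth : ContDiff ℝ (⊤ : ℕ∞) φ
  compactSupport : HasCompactSupport φ
  nonneg : ∀ τ, 0 ≤ φ τ
  support_subset : ∀ τ, φ τ ≠ 0 → 1 / 2 ≤ |τ| ∧ |τ| ≤ 2
  pos : ∀ τ, 1 / Real.sqrt 2 ≤ |τ| → |τ| ≤ Real.sqrt 2 → 0 < φ τ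

/-- ∑_{j∈ℤ} φ(2^{−j}τ). -/
def lpSum (φ : ℝ → ℝ) (τ : ℝ) : ℝ := ∑' j : ℤ, φ (τ / 2 ^ j)

/-- The Littlewood–Paley pieces φ̂_k: φ̂_k(τ) = φ(2^{−k}τ)/∑_{j∈ℤ}φ(2^{−j}τ) for k ≥ 1,
    φ̂_0 = 1 − ∑_{k≥1} φ̂_k. -/
def lpPiece (φ : ℝ → ℝ) : ℕ → ℝ → ℝ
  | 0, τ => 1 - ∑' k : ℕ, φ (τ / 2 ^ (k + 1)) / lpSum φ τ
  | k + 1, τ => φ (τ / 2 ^ (k + 1)) / lpSum φ τ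

/-- Bourgain–Besov norm ‖f‖_{X^{a,b,1}_s}. -/
def XnormB (φ : ℝ → ℝ) (a b s : ℝ) (f : SpaceTime → ℂ) : ℝ :=
  ∑' k : ℕ, (2 : ℝ) ^ (b * k) *
    l2F fun τ ξ => ((jap ‖ξ‖ ^ a * lpPiece φ k (τ + s * ‖ξ‖) : ℝ) : ℂ) * ftST f τ ξ

/-- Bourgain–Besov norm ‖f‖_{X^{a,b,∞}_s}. -/
def XnormBinf (φ : ℝ → ℝ) (a b s : ℝ) (f : SpaceTime → ℂ) : ℝ :=
  ⨆ k : ℕ, (2 : ℝ) ^ (b * k) *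
    l2F fun τ ξ => ((jap ‖ξ‖ ^ a * lpPiece φ k (τ + s * ‖ξ‖) : ℝ) : ℂ) * ftST f τ ξ

/-- Mixed norm ‖f‖_{L^q_t L^r_x}. -/
def mixedNorm (q r : ℝ) (f : SpaceTime → ℂ) : ℝ :=
  (∫ t : ℝ, (∫ x : E2, ‖f (t, x)‖ ^ r) ^ (q / r)) ^ (1 / q)

/-- L² norm on the slab [0,T] × ℝ². -/
def l2Slab (T : ℝ) (f : SpaceTime → ℂ) : ℝ :=
  Real.sqrt (∫ t in Set.Icc (0 : ℝ) T, ∫ x : E2, ‖f (t, x)‖ ^ 2)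
/-- The angle between two vectors of ℝ², interpreted as 0 if one of them vanishes. -/
def angOrZero (a b : E2) : ℝ :=
  if a = 0 ∨ b = 0 then 0 else InnerProductGeometry.angle a b

/-- The space–time Fourier transform of a Schwartz function is a Schwartz function. -/
lemma exists_schwartz_eq_ftST (f : SchwartzMap SpaceTime ℂ) :
    ∃ g : SchwartzMap SpaceTime ℂ, ∀ τ ξ, ftST (fun p => f p) τ ξ = g (τ, ξ) := by
  let e := WithLp.prodContinuousLinearEquiv 2 ℝ ℝ E2
  let h : SchwartzMap (WithLp 2 (ℝ × E2)) ℂ := SchwartzMap.compCLMOfContinuousLinearEquiv ℂ e f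
  let sc : SpaceTime ≃L[ℝ] SpaceTime :=
    ContinuousLinearEquiv.smulLeft (Units.mk0 ((2 * Real.pi)⁻¹ : ℝ) (by positivity))
  refine ⟨SchwartzMap.compCLMOfContinuousLinearEquiv ℂ (sc.trans e.symm)
    (FourierTransform.fourier h), fun τ ξ => ?_⟩
  rw [SchwartzMap.compCLMOfContinuousLinearEquiv_apply, SchwartzMap.fourier_coe,
    Function.comp_apply, Real.fourier_eq', ftST,
    ← (WithLp.volume_preserving_toLp ℝ E2).integral_comp
      (MeasurableEquiv.toLp 2 (ℝ × E2)).measurableEmbedding]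
  refine integral_congr_ae (Filter.Eventually.of_forall fun p => ?_)
  have h1 : h (WithLp.toLp 2 p) = f p := rfl
  have h2 : (sc.trans e.symm) (τ, ξ) =
    WithLp.toLp 2 ((2 * Real.pi)⁻¹ * τ, (2 * Real.pi)⁻¹ • ξ) := rfl
  simp only [h1, h2, smul_eq_mul, WithLp.prod_inner_apply]
  congr 2
  have := Real.pi_ne_zero
  simp only [inner_smul_right, RCLike.inner_apply, conj_trivial]
  push_cast
  have : (Real.pi : ℂ) ≠ 0 := by exact_mod_cast this
  field_simp

namespace IsLPBump

variable {φ : ℝ → ℝ}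

lemma tsum_lpPiece_succ_eq (τ : ℝ) :
    ∑' k : ℕ, lpPiece φ (k + 1) τ = (∑' k : ℕ, φ (τ / 2 ^ ((k : ℤ) + 1))) / lpSum φ τ := by
  rw [← tsum_div_const]
  refine tsum_congr fun k => ?_
  simp only [lpPiece]
  norm_cast

variable (h : IsLPBump φ)
include h

lemma ne_zero_iff_bounds {τ : ℝ} {j : ℤ} (hj : φ (τ / 2 ^ j) ≠ 0) :
    (2 : ℝ) ^ (j - 1) ≤ |τ| ∧ |τ| ≤ 2 ^ (j + 1) := by
  have h2 : (0 : ℝ) < 2 ^ j := by positivity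
  have := h.support_subset _ hj
  rw [abs_div, abs_of_pos h2, div_le_div_iff₀ (by norm_num) h2, div_le_iff₀ h2] at this
  rw [zpow_sub₀ (by norm_num), zpow_add₀ (by norm_num)]
  constructor <;> norm_num <;> linarith

lemma map_zero : φ 0 = 0 := by
  by_contra h0
  have := (h.support_subset 0 h0).1
  norm_num at this

lemma finite_support (τ : ℝ) : (Function.support fun j : ℤ => φ (τ / 2 ^ j)).Finite := by
  rcases eq_or_ne τ 0 with rfl | hτ
  · simp [h.map_zero]
  obtain ⟨n, hn⟩ := exists_mem_Ico_zpow (abs_pos.2 hτ) (one_lt_two (α := ℝ))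
  refine (Set.finite_Icc (n - 1) (n + 2)).subset fun j hj => ?_
  have hb := h.ne_zero_iff_bounds hj
  have h1 := (zpow_lt_zpow_iff_right₀ (one_lt_two (α := ℝ))).1 (hb.1.trans_lt hn.2)
  have h2 := (zpow_le_zpow_iff_right₀ (one_lt_two (α := ℝ))).1 (hn.1.trans hb.2)
  constructor <;> omega

lemma summable (τ : ℝ) : Summable fun j : ℤ => φ (τ / 2 ^ j) :=
  summable_of_hasFiniteSupport (h.finite_support τ)

lemma lpSum_pos {τ : ℝ} (hτ : τ ≠ 0) : 0 < lpSum φ τ := by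
  have hs : (0 : ℝ) < Real.sqrt 2 := by positivity
  have hss : Real.sqrt 2 * Real.sqrt 2 = 2 := Real.mul_self_sqrt (by norm_num)
  obtain ⟨n, hn1, hn2⟩ :=
    exists_mem_Ico_zpow (mul_pos hs (abs_pos.2 hτ)) (one_lt_two (α := ℝ))
  have h2 : (0 : ℝ) < 2 ^ n := by positivity
  refine (h.summable τ).tsum_pos (fun j => h.nonneg _) n (h.pos _ ?_ ?_)
  · rw [abs_div, abs_of_pos h2, div_le_div_iff₀ hs h2]
    linarith
  · rw [abs_div, abs_of_pos h2, div_le_iff₀ h2]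
    rw [zpow_add_one₀ (by norm_num)] at hn2
    nlinarith

lemma lpSum_nonneg (τ : ℝ) : 0 ≤ lpSum φ τ := tsum_nonneg fun _ => h.nonneg _

lemma lpPiece_succ_nonneg (k : ℕ) (τ : ℝ) : 0 ≤ lpPiece φ (k + 1) τ :=
  div_nonneg (h.nonneg _) (h.lpSum_nonneg τ)

lemma summable_lpPiece_succ (τ : ℝ) : Summable fun k : ℕ => lpPiece φ (k + 1) τ := by
  have hinj : Function.Injective fun k : ℕ => ((k : ℤ) + 1) := fun a b hab => by simpa using hab
  have := ((h.summable τ).comp_injective hinj).div_const (lpSum φ τ)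
  refine this.congr fun k => ?_
  simp only [lpPiece, Function.comp]
  norm_cast

lemma tsum_lpPiece_succ_le_one (τ : ℝ) : ∑' k : ℕ, lpPiece φ (k + 1) τ ≤ 1 := by
  have hinj : Function.Injective fun k : ℕ => ((k : ℤ) + 1) := fun a b hab => by simpa using hab
  rw [tsum_lpPiece_succ_eq]
  exact div_le_one_of_le₀ (tsum_comp_le_tsum_of_inj (h.summable τ) (fun _ => h.nonneg _) hinj)
    (h.lpSum_nonneg τ)

lemma tsum_lpPiece_succ_eq_one {τ : ℝ} (hτ : 2 < |τ|) : ∑' k : ℕ, lpPiece φ (k + 1) τ = 1 := by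
  have hinj : Function.Injective fun k : ℕ => ((k : ℤ) + 1) := fun a b hab => by simpa using hab
  have h0 : τ ≠ 0 := by rintro rfl; norm_num at hτ
  rw [tsum_lpPiece_succ_eq]
  rw [hinj.tsum_eq (f := fun j : ℤ => φ (τ / 2 ^ j))]
  · exact div_self (h.lpSum_pos h0).ne'
  · intro j hj
    have hb := h.ne_zero_iff_bounds hj
    have : (2 : ℝ) ^ (1 : ℤ) < 2 ^ (j + 1) := by
      rw [zpow_one]; exact hτ.trans_le hb.2
    have := (zpow_lt_zpow_iff_right₀ (one_lt_two (α := ℝ))).1 this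
    exact ⟨(j - 1).toNat, by simp only; omega⟩

lemma lpPiece_nonneg (k : ℕ) (τ : ℝ) : 0 ≤ lpPiece φ k τ := by
  cases k with
  | zero => exact sub_nonneg.2 (h.tsum_lpPiece_succ_le_one τ)
  | succ k => exact h.lpPiece_succ_nonneg k τ

lemma tsum_ofReal_lpPiece (τ : ℝ) : ∑' k : ℕ, ENNReal.ofReal (lpPiece φ k τ) = 1 := by
  have hs : Summable fun k : ℕ => lpPiece φ k τ :=
    (summable_nat_add_iff 1).1 (h.summable_lpPiece_succ τ)
  rw [← ENNReal.ofReal_tsum_of_nonneg (fun k => h.lpPiece_nonneg k τ) hs, hs.tsum_eq_zero_add]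
  simp [lpPiece]

lemma lpPiece_le_one (k : ℕ) (τ : ℝ) : lpPiece φ k τ ≤ 1 := by
  have := ENNReal.le_tsum (f := fun k => ENNReal.ofReal (lpPiece φ k τ)) k
  rw [h.tsum_ofReal_lpPiece] at this
  exact ENNReal.ofReal_le_one.1 this

lemma abs_le_of_lpPiece_ne_zero {k : ℕ} {τ : ℝ} (hk : lpPiece φ k τ ≠ 0) :
    |τ| ≤ 2 * 2 ^ k := by
  cases k with
  | zero =>
    by_contra! hτ
    refine hk (sub_eq_zero.2 ?_)
    exact (h.tsum_lpPiece_succ_eq_one (by simpa using hτ)).symm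
  | succ k =>
    have h1 : φ (τ / 2 ^ ((k + 1 : ℕ) : ℤ)) ≠ 0 := by
      rw [zpow_natCast]
      exact fun h0 => hk (by simp [lpPiece, h0])
    have := (h.ne_zero_iff_bounds h1).2
    rw [zpow_add_one₀ (by norm_num), zpow_natCast] at this
    linarith

lemma le_abs_of_lpPiece_ne_zero {k : ℕ} {τ : ℝ} (hk : lpPiece φ (k + 1) τ ≠ 0) :
    2 ^ k ≤ |τ| := by
  have h1 : φ (τ / 2 ^ ((k + 1 : ℕ) : ℤ)) ≠ 0 := by
    rw [zpow_natCast]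
    exact fun h0 => hk (by simp [lpPiece, h0])
  have := (h.ne_zero_iff_bounds h1).1
  simpa using this

lemma measurable : Measurable φ := h.smooth.continuous.measurable

lemma measurable_lpSum : Measurable (lpSum φ) := by
  have := h.measurable
  have he : lpSum φ = fun τ => (∑' j : ℤ, ENNReal.ofReal (φ (τ / 2 ^ j))).toReal := by
    funext τ
    rw [← ENNReal.ofReal_tsum_of_nonneg (fun _ => h.nonneg _) (h.summable τ)]
    exact (ENNReal.toReal_ofReal (h.lpSum_nonneg τ)).symm
  rw [he]
  fun_prop

lemma measurable_lpPiece (k : ℕ) : Measurable (lpPiece φ k) := by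
  have := h.measurable
  have := h.measurable_lpSum
  have hsucc : ∀ k, Measurable (lpPiece φ (k + 1)) := fun k => by
    unfold lpPiece; fun_prop
  cases k with
  | succ k => exact hsucc k
  | zero =>
    have he : lpPiece φ 0 =
        fun τ => 1 - (∑' k : ℕ, ENNReal.ofReal (lpPiece φ (k + 1) τ)).toReal := by
      funext τ
      rw [← ENNReal.ofReal_tsum_of_nonneg (fun k => h.lpPiece_succ_nonneg k τ)
        (h.summable_lpPiece_succ τ),
        ENNReal.toReal_ofReal (tsum_nonneg fun k => h.lpPiece_succ_nonneg k τ)]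
      rfl
    rw [he]
    fun_prop

end IsLPBump

instance : (volume : Measure SpaceTime).IsAddHaarMeasure :=
  inferInstanceAs ((volume : Measure ℝ).prod (volume : Measure E2)).IsAddHaarMeasure

/-- The `L²` norm of a nonnegative function on space-time. -/
def lnorm (F : SpaceTime → ENNReal) : ENNReal := (∫⁻ p, F p ^ 2) ^ (1 / 2 : ℝ)

/-- The trilinear convolution form with kernel `K`. -/
def triForm (K : SpaceTime → SpaceTime → ENNReal) (F G H : SpaceTime → ENNReal) : ENNReal :=
  ∫⁻ q, ∫⁻ p, K p q * F p * G (p - q) * H q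

/-- The trilinear form with kernel `K` is bounded by `B` on `L² × L² × L²`. -/
def TriBounded (K : SpaceTime → SpaceTime → ENNReal) (B : ENNReal) : Prop :=
  ∀ F G H : SpaceTime → ENNReal, Measurable F → Measurable G → Measurable H →
    triForm K F G H ≤ B * (lnorm F * lnorm G * lnorm H)

lemma lintegral_mul_le_sq {α : Type*} [MeasurableSpace α] (μ : Measure α) {f g : α → ENNReal}
    (hf : AEMeasurable f μ) (hg : AEMeasurable g μ) :
    ∫⁻ a, f a * g a ∂μ ≤ (∫⁻ a, f a ^ 2 ∂μ) ^ (1 / 2 : ℝ) * (∫⁻ a, g a ^ 2 ∂μ) ^ (1 / 2 : ℝ) := by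
  have := ENNReal.lintegral_mul_le_Lp_mul_Lq μ Real.HolderConjugate.two_two hf hg
  simpa [Pi.mul_apply] using this

lemma sq_rpow_half (a : ENNReal) : (a ^ 2) ^ (1 / 2 : ℝ) = a := by
  rw [← ENNReal.rpow_natCast, ← ENNReal.rpow_mul]
  norm_num

lemma rpow_half_sq (a : ENNReal) : (a ^ (1 / 2 : ℝ)) ^ 2 = a := by
  rw [← ENNReal.rpow_natCast, ← ENNReal.rpow_mul]
  norm_num

lemma lnorm_sq (F : SpaceTime → ENNReal) : lnorm F ^ 2 = ∫⁻ p, F p ^ 2 := rpow_half_sq _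

lemma lintegral_bilinear_le {α β : Type*} [MeasurableSpace α] [MeasurableSpace β]
    (μ : Measure α) (ν : Measure β) [SFinite μ] [SFinite ν] {K X : α → β → ENNReal}
    {Y : β → ENNReal} {B : ENNReal} (hK : Measurable (Function.uncurry K))
    (hX : Measurable (Function.uncurry X)) (hY : Measurable Y)
    (hB : ∀ q, ∫⁻ p, K p q ^ 2 ∂μ ≤ B ^ 2) :
    ∫⁻ q, ∫⁻ p, K p q * X p q * Y q ∂μ ∂ν ≤
      B * ((∫⁻ q, ∫⁻ p, X p q ^ 2 ∂μ ∂ν) ^ (1 / 2 : ℝ) * (∫⁻ q, Y q ^ 2 ∂ν) ^ (1 / 2 : ℝ)) := by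
  have hXm : Measurable fun q => ∫⁻ p, X p q ^ 2 ∂μ :=
    Measurable.lintegral_prod_left' (f := fun z : α × β => X z.1 z.2 ^ 2) (hX.pow_const 2)
  calc ∫⁻ q, ∫⁻ p, K p q * X p q * Y q ∂μ ∂ν
      ≤ ∫⁻ q, B * ((∫⁻ p, X p q ^ 2 ∂μ) ^ (1 / 2 : ℝ) * Y q) ∂ν := by
        refine lintegral_mono fun q => ?_
        have h1 : Measurable fun p => K p q := hK.comp measurable_prodMk_right
        have h2 : Measurable fun p => X p q := hX.comp measurable_prodMk_right
        rw [lintegral_mul_const (f := fun p => K p q * X p q) _ (h1.mul h2), ← mul_assoc]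
        gcongr
        refine (lintegral_mul_le_sq μ h1.aemeasurable h2.aemeasurable).trans ?_
        gcongr
        calc _ ≤ (B ^ 2) ^ (1 / 2 : ℝ) := by gcongr; exact hB q
          _ = B := sq_rpow_half B
    _ ≤ _ := by
        rw [lintegral_const_mul (f := fun q => (∫⁻ p, X p q ^ 2 ∂μ) ^ (1 / 2 : ℝ) * Y q) _
          ((hXm.pow_const _).mul hY)]
        gcongr
        refine (lintegral_mul_le_sq ν (hXm.pow_const _).aemeasurable hY.aemeasurable).trans ?_
        simp only [rpow_half_sq, le_refl]

lemma rpow_half_mul (a b : ENNReal) :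
    (a * b) ^ (1 / 2 : ℝ) = a ^ (1 / 2 : ℝ) * b ^ (1 / 2 : ℝ) :=
  ENNReal.mul_rpow_of_nonneg _ _ (by norm_num)

lemma measurable_uncurry_triForm {K : SpaceTime → SpaceTime → ENNReal} {F G H : SpaceTime → ENNReal}
    (hK : Measurable (Function.uncurry K)) (hF : Measurable F) (hG : Measurable G)
    (hH : Measurable H) :
    Measurable (Function.uncurry fun p q => K p q * F p * G (p - q) * H q) :=
  ((hK.mul (hF.comp measurable_fst)).mul (hG.comp (measurable_fst.sub measurable_snd))).mul
    (hH.comp measurable_snd)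

lemma triBounded_of_fst {K : SpaceTime → SpaceTime → ENNReal} {B : ENNReal}
    (hK : Measurable (Function.uncurry K)) (hB : ∀ q, ∫⁻ p, K p q ^ 2 ≤ B ^ 2) :
    TriBounded K B := by
  intro F G H hF hG hH
  have hGm : Measurable fun z : SpaceTime × SpaceTime => G (z.1 - z.2) :=
    hG.comp (measurable_fst.sub measurable_snd)
  have hX : Measurable (Function.uncurry fun p q => F p * G (p - q)) :=
    (hF.comp measurable_fst).mul hGm
  have key := lintegral_bilinear_le volume volume hK hX hH hB
  have hXi : ∫⁻ q, ∫⁻ p, (F p * G (p - q)) ^ 2 = (∫⁻ p, F p ^ 2) * ∫⁻ p, G p ^ 2 := by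
    rw [lintegral_lintegral_swap
      (f := fun q p => (F p * G (p - q)) ^ 2)
      ((hX.pow_const 2).comp measurable_swap).aemeasurable,
      ← lintegral_mul_const _ (hF.pow_const 2)]
    refine lintegral_congr fun p => ?_
    simp only [mul_pow]
    rw [lintegral_const_mul (f := fun q => G (p - q) ^ 2) _
      ((hGm.comp measurable_prodMk_left).pow_const 2)]
    congr 1
    exact lintegral_sub_left_eq_self (fun q => G q ^ 2) p
  rw [hXi, rpow_half_mul] at key
  simpa only [triForm, lnorm, mul_assoc] using key

lemma triBounded_of_snd {K : SpaceTime → SpaceTime → ENNReal} {B : ENNReal}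
    (hK : Measurable (Function.uncurry K)) (hB : ∀ p, ∫⁻ q, K p q ^ 2 ≤ B ^ 2) :
    TriBounded K B := by
  intro F G H hF hG hH
  have hGm : Measurable fun z : SpaceTime × SpaceTime => G (z.2 - z.1) :=
    hG.comp (measurable_snd.sub measurable_fst)
  have hX : Measurable (Function.uncurry fun q p => G (p - q) * H q) :=
    hGm.mul (hH.comp measurable_fst)
  have key := lintegral_bilinear_le (K := fun q p => K p q) volume volume
    (hK.comp measurable_swap) hX hF hB
  have hXi : ∫⁻ p, ∫⁻ q, (G (p - q) * H q) ^ 2 = (∫⁻ p, G p ^ 2) * ∫⁻ p, H p ^ 2 := by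
    rw [lintegral_lintegral_swap
      (f := fun p q => (G (p - q) * H q) ^ 2)
      ((hX.pow_const 2).comp measurable_swap).aemeasurable,
      ← lintegral_const_mul _ (hH.pow_const 2)]
    refine lintegral_congr fun q => ?_
    simp only [mul_pow]
    rw [lintegral_mul_const (f := fun p => G (p - q) ^ 2) _
      ((hGm.comp measurable_prodMk_left).pow_const 2)]
    congr 1
    exact lintegral_sub_right_eq_self (fun q => G q ^ 2) q
  rw [hXi, rpow_half_mul] at key
  rw [triForm, lintegral_lintegral_swap (f := fun q p => K p q * F p * G (p - q) * H q)
    ((measurable_uncurry_triForm hK hF hG hH).comp measurable_swap).aemeasurable]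
  calc _ = _ := lintegral_congr fun p => lintegral_congr fun q => ?_
    _ ≤ _ := key
    _ = _ := ?_
  · ring
  · simp only [lnorm]; ring

lemma triForm_swap (K : SpaceTime → SpaceTime → ENNReal) (F G H : SpaceTime → ENNReal) :
    triForm K F G H = triForm (fun p q => K (p - q) (-q)) G F (fun q => H (-q)) := by
  rw [triForm, triForm, ← lintegral_neg_eq_self]
  refine lintegral_congr fun q => ?_
  rw [← lintegral_sub_right_eq_self _ q]
  refine lintegral_congr fun p => ?_
  rw [sub_neg_eq_add, sub_add_cancel]
  ring

lemma lnorm_comp_neg (H : SpaceTime → ENNReal) : lnorm (fun q => H (-q)) = lnorm H := by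
  rw [lnorm, lnorm]
  congr 1
  exact lintegral_neg_eq_self (μ := (volume : Measure SpaceTime)) fun q => H q ^ 2

lemma TriBounded.swap {K : SpaceTime → SpaceTime → ENNReal} {B : ENNReal}
    (h : TriBounded (fun p q => K (p - q) (-q)) B) : TriBounded K B := by
  intro F G H hF hG hH
  rw [triForm_swap]
  refine (h G F _ hG hF (hH.comp measurable_neg)).trans_eq ?_
  rw [show lnorm (H ∘ Neg.neg) = lnorm H from lnorm_comp_neg H, mul_comm (lnorm G)]

lemma triBounded_of_sub {K : SpaceTime → SpaceTime → ENNReal} {B : ENNReal}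
    (hK : Measurable (Function.uncurry K)) (hB : ∀ p', ∫⁻ p, K p (p - p') ^ 2 ≤ B ^ 2) :
    TriBounded K B := by
  refine TriBounded.swap (triBounded_of_snd ?_ fun p' => ?_)
  · exact hK.comp ((measurable_fst.sub measurable_snd).prodMk measurable_snd.neg)
  · rw [← lintegral_sub_left_eq_self _ p']
    refine le_trans (le_of_eq ?_) (hB p')
    refine lintegral_congr fun p => ?_
    simp

lemma TriBounded.mono {K K' : SpaceTime → SpaceTime → ENNReal} {B B' : ENNReal}
    (h : TriBounded K B) (hK : ∀ p q, K' p q ≤ K p q) (hB : B ≤ B') : TriBounded K' B' := by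
  intro F G H hF hG hH
  refine le_trans ?_ ((h F G H hF hG hH).trans (mul_le_mul_left hB _))
  unfold triForm
  gcongr
  exact hK _ _

lemma TriBounded.add {K K' : SpaceTime → SpaceTime → ENNReal} {B B' : ENNReal}
    (hK : Measurable (Function.uncurry K))
    (h : TriBounded K B) (h' : TriBounded K' B') : TriBounded (fun p q => K p q + K' p q) (B + B') := by
  intro F G H hF hG hH
  have hm := measurable_uncurry_triForm hK hF hG hH
  calc _ = triForm K F G H + triForm K' F G H := by
        unfold triForm
        rw [← lintegral_add_left (Measurable.lintegral_prod_left'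
          (f := fun z : SpaceTime × SpaceTime => K z.1 z.2 * F z.1 * G (z.1 - z.2) * H z.2) hm)]
        refine lintegral_congr fun q => ?_
        rw [← lintegral_add_left (f := fun p => K p q * F p * G (p - q) * H q)
          (hm.comp measurable_prodMk_right)]
        refine lintegral_congr fun p => ?_
        ring
    _ ≤ _ := by
        rw [add_mul]
        exact add_le_add (h F G H hF hG hH) (h' F G H hF hG hH)

/-- Orthogonality: if the kernel forces `ρ (p - q)` and `ρ q` to be within `N`, then it is enough to
bound it on the shells `s ≤ ρ q ≤ s + N`. -/
lemma triBounded_of_orthogonal {K : SpaceTime → SpaceTime → ENNReal} {B : ENNReal}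
    (hK : Measurable (Function.uncurry K)) {ρ : SpaceTime → ℝ} (hρ : Measurable ρ) {N : ℝ}
    (hN : 0 < N) (hKN : ∀ p q, K p q ≠ 0 → |ρ (p - q) - ρ q| ≤ N)
    (hB : ∀ (s : ℝ) p, ∫⁻ q, {q | s ≤ ρ q ∧ ρ q ≤ s + N}.indicator (fun q => K p q) q ^ 2 ≤ B ^ 2) :
    TriBounded K (2 * B) := by
  intro F G H hF hG hH
  let I : ℝ → SpaceTime → ENNReal := fun s q => {x : ℝ × ℝ | x.1 ≤ x.2 ∧ x.2 ≤ x.1 + N}.indicator 1 (s, ρ q)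
  let J : ℝ → SpaceTime → ENNReal :=
    fun s q => {x : ℝ × ℝ | x.1 - N ≤ x.2 ∧ x.2 ≤ x.1 + 2 * N}.indicator 1 (s, ρ q)
  have hIset : MeasurableSet {x : ℝ × ℝ | x.1 ≤ x.2 ∧ x.2 ≤ x.1 + N} :=
    (measurableSet_le measurable_fst measurable_snd).inter
      (measurableSet_le measurable_snd (measurable_fst.add_const _))
  have hJset : MeasurableSet {x : ℝ × ℝ | x.1 - N ≤ x.2 ∧ x.2 ≤ x.1 + 2 * N} :=
    (measurableSet_le (measurable_fst.sub_const _) measurable_snd).inter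
      (measurableSet_le measurable_snd (measurable_fst.add_const _))
  have hIm : Measurable (Function.uncurry I) :=
    (measurable_one.indicator hIset).comp (measurable_fst.prodMk (hρ.comp measurable_snd))
  have hJm : Measurable (Function.uncurry J) :=
    (measurable_one.indicator hJset).comp (measurable_fst.prodMk (hρ.comp measurable_snd))
  have hIint : ∀ q, ∫⁻ s, I s q = ENNReal.ofReal N := fun q => by
    have : ∀ s, I s q = (Set.Icc (ρ q - N) (ρ q)).indicator 1 s := fun s => by
      simp only [I, Set.indicator_apply, Set.mem_ofPred_eq, Set.mem_Icc]
      congr 1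
      exact propext ⟨fun h => ⟨by linarith [h.2], h.1⟩, fun h => ⟨h.2, by linarith [h.1]⟩⟩
    simp_rw [this]
    rw [lintegral_indicator_one measurableSet_Icc, Real.volume_Icc]
    congr 1; ring
  have hJint : ∀ q, ∫⁻ s, J s q = 3 * ENNReal.ofReal N := fun q => by
    have : ∀ s, J s q = (Set.Icc (ρ q - 2 * N) (ρ q + N)).indicator 1 s := fun s => by
      simp only [J, Set.indicator_apply, Set.mem_ofPred_eq, Set.mem_Icc]
      congr 1
      exact propext ⟨fun h => ⟨by linarith [h.2], by linarith [h.1]⟩,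
        fun h => ⟨by linarith [h.2], by linarith [h.1]⟩⟩
    simp_rw [this]
    rw [lintegral_indicator_one measurableSet_Icc, Real.volume_Icc,
      show (3 : ENNReal) = ENNReal.ofReal 3 by simp, ← ENNReal.ofReal_mul (by norm_num)]
    congr 1; ring
  have hIsq : ∀ s q, I s q ^ 2 = I s q := fun s q => by
    simp only [I, Set.indicator_apply]; split_ifs <;> simp
  have hJsq : ∀ s q, J s q ^ 2 = J s q := fun s q => by
    simp only [J, Set.indicator_apply]; split_ifs <;> simp
  have hIs : ∀ s, Measurable (I s) := fun s => hIm.comp measurable_prodMk_left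
  have hJs : ∀ s, Measurable (J s) := fun s => hJm.comp measurable_prodMk_left
  have hloc : ∀ s, triForm (fun p q => K p q * I s q) F (fun p => J s p * G p)
      (fun q => I s q * H q) ≤
      B * (lnorm F * lnorm (fun p => J s p * G p) * lnorm (fun q => I s q * H q)) := fun s => by
    refine triBounded_of_snd (K := fun p q => K p q * I s q) (hK.mul ((hIs s).comp measurable_snd)) (fun p => ?_) _ _ _ hF
      ((hJs s).mul hG) ((hIs s).mul hH)
    refine le_trans (lintegral_mono fun q => ?_) (hB s p)
    simp only [I, Set.indicator_apply, Set.mem_ofPred_eq]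
    split_ifs <;> simp
  have hnorm : ∀ {c : ENNReal} (Λ : ℝ → SpaceTime → ENNReal), Measurable (Function.uncurry Λ) →
      (∀ s q, Λ s q ^ 2 = Λ s q) → (∀ q, ∫⁻ s, Λ s q = c) → ∀ X : SpaceTime → ENNReal,
      Measurable X → ∫⁻ s, lnorm (fun p => Λ s p * X p) ^ 2 = c * lnorm X ^ 2 := by
    intro c Λ hΛ hsq hint X hX
    simp_rw [lnorm_sq]
    rw [lintegral_lintegral_swap (f := fun s p => (Λ s p * X p) ^ 2)
      ((hΛ.mul (hX.comp measurable_snd)).pow_const 2).aemeasurable,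
      ← lintegral_const_mul _ (hX.pow_const 2)]
    refine lintegral_congr fun p => ?_
    simp only [mul_pow, hsq]
    rw [lintegral_mul_const (f := fun s => Λ s p) _ (hΛ.comp measurable_prodMk_right), hint]
  have hnm : ∀ (Λ : ℝ → SpaceTime → ENNReal), Measurable (Function.uncurry Λ) →
      ∀ X : SpaceTime → ENNReal, Measurable X → Measurable fun s => lnorm (fun p => Λ s p * X p) := by
    intro Λ hΛ X hX
    exact (Measurable.lintegral_prod_right' (f := fun z : ℝ × SpaceTime => (Λ z.1 z.2 * X z.2) ^ 2)
      ((hΛ.mul (hX.comp measurable_snd)).pow_const 2)).pow_const _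
  set c := ENNReal.ofReal N with hc
  have hc0 : c ≠ 0 := by simpa [hc] using hN
  have hct : c ≠ ⊤ := ENNReal.ofReal_ne_top
  have hlhs : ∫⁻ s, triForm (fun p q => K p q * I s q) F (fun p => J s p * G p)
      (fun q => I s q * H q) = c * triForm K F G H := by
    have hpt : ∀ s p q, K p q * I s q * F p * (J s (p - q) * G (p - q)) * (I s q * H q) =
        I s q * (K p q * F p * G (p - q) * H q) := by
      intro s p q
      by_cases hk : K p q = 0
      · simp [hk]
      have := abs_le.1 (hKN p q hk)
      by_cases hI : s ≤ ρ q ∧ ρ q ≤ s + N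
      · have h1 : I s q = 1 := Set.indicator_of_mem (s := {x : ℝ × ℝ | _}) hI 1
        have h2 : J s (p - q) = 1 := Set.indicator_of_mem (s := {x : ℝ × ℝ | _})
          (show s - N ≤ ρ (p - q) ∧ ρ (p - q) ≤ s + 2 * N by constructor <;> linarith) 1
        rw [h1, h2]; ring
      · have h1 : I s q = 0 := Set.indicator_of_notMem (s := {x : ℝ × ℝ | _}) hI 1
        simp [h1]
    have hm := measurable_uncurry_triForm hK hF hG hH
    have hmq : Measurable fun q => ∫⁻ p, K p q * F p * G (p - q) * H q :=
      Measurable.lintegral_prod_left'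
        (f := fun z : SpaceTime × SpaceTime => K z.1 z.2 * F z.1 * G (z.1 - z.2) * H z.2) hm
    simp only [triForm, hpt]
    have h1 : ∀ s q, ∫⁻ p, I s q * (K p q * F p * G (p - q) * H q) =
        I s q * ∫⁻ p, K p q * F p * G (p - q) * H q := fun s q =>
      lintegral_const_mul _ (hm.comp measurable_prodMk_right)
    simp only [h1]
    rw [lintegral_lintegral_swap
      (f := fun s q => I s q * ∫⁻ p, K p q * F p * G (p - q) * H q)
      (hIm.mul (hmq.comp measurable_snd)).aemeasurable, ← lintegral_const_mul _ hmq]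
    refine lintegral_congr fun q => ?_
    rw [lintegral_mul_const (f := fun s => I s q) _ (hIm.comp measurable_prodMk_right), hIint]
  have hrhs : ∫⁻ s, lnorm (fun p => J s p * G p) * lnorm (fun q => I s q * H q) ≤
      c * (2 * (lnorm G * lnorm H)) := by
    refine (lintegral_mul_le_sq volume (hnm J hJm G hG).aemeasurable
      (hnm I hIm H hH).aemeasurable).trans ?_
    rw [hnorm J hJm hJsq hJint G hG, hnorm I hIm hIsq hIint H hH, ← rpow_half_mul]
    refine le_trans ?_ (sq_rpow_half _).le
    gcongr
    calc _ = 3 * (c * (lnorm G * lnorm H)) ^ 2 := by ring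
      _ ≤ 4 * (c * (lnorm G * lnorm H)) ^ 2 := by gcongr; norm_num
      _ = _ := by ring
  have hfin : c * triForm K F G H ≤ c * (2 * B * (lnorm F * lnorm G * lnorm H)) := by
    rw [← hlhs]
    refine (lintegral_mono hloc).trans ?_
    have : ∀ s, B * (lnorm F * lnorm (fun p => J s p * G p) * lnorm (fun q => I s q * H q)) =
        (B * lnorm F) * (lnorm (fun p => J s p * G p) * lnorm (fun q => I s q * H q)) :=
      fun s => by ring
    simp only [this]
    rw [lintegral_const_mul (f := fun s => lnorm (fun p => J s p * G p) *
      lnorm (fun q => I s q * H q)) _ ((hnm J hJm G hG).mul (hnm I hIm H hH))]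
    refine (mul_le_mul_right hrhs _).trans_eq ?_
    ring
  exact (ENNReal.mul_le_mul_iff_right hc0 hct).1 hfin

lemma abs_cos_sub_cos_ge {α β : ℝ} (hα : α ∈ Set.Icc 0 Real.pi) (hβ : β ∈ Set.Icc 0 Real.pi) :
    2 * ((α - β) / Real.pi) ^ 2 ≤ |Real.cos α - Real.cos β| := by
  wlog hab : α ≤ β generalizing α β with H
  · have := H hβ hα (le_of_not_ge hab)
    rw [abs_sub_comm, ← neg_sub α β, neg_div, neg_sq] at this
    exact this
  obtain ⟨hα0, hα1⟩ := hα
  obtain ⟨hβ0, hβ1⟩ := hβ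
  have hpi := Real.pi_pos
  set d := (β - α) / 2 with hd
  have hd0 : 0 ≤ d := by rw [hd]; linarith
  have h1 : 2 / Real.pi * d ≤ Real.sin d := Real.mul_le_sin hd0 (by rw [hd]; linarith)
  have h2 : 2 / Real.pi * d ≤ Real.sin ((α + β) / 2) := by
    rcases le_total ((α + β) / 2) (Real.pi / 2) with h | h
    · refine le_trans ?_ (Real.mul_le_sin (by linarith) h)
      gcongr; linarith
    · rw [← Real.sin_pi_sub]
      refine le_trans ?_ (Real.mul_le_sin (by linarith) (by linarith))
      gcongr; linarith
  have h3 : Real.cos α - Real.cos β = 2 * (Real.sin ((α + β) / 2) * Real.sin d) := by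
    rw [Real.cos_sub_cos, show (α - β) / 2 = -d by rw [hd]; ring, Real.sin_neg]; ring
  have h0 : 0 ≤ 2 / Real.pi * d := by positivity
  calc 2 * ((α - β) / Real.pi) ^ 2 = 2 * ((2 / Real.pi * d) * (2 / Real.pi * d)) := by
        rw [hd]; field_simp; ring
    _ ≤ 2 * (Real.sin ((α + β) / 2) * Real.sin d) := by gcongr; exact h0.trans h2
    _ ≤ _ := by rw [← h3]; exact le_abs_self _

/-- The third side of a triangle with sides `n`, `R` enclosing the angle `α`. -/
def thirdSide (n R α : ℝ) : ℝ := √(n ^ 2 + R ^ 2 - 2 * n * R * Real.cos α)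

lemma thirdSide_radicand_nonneg {n R : ℝ} (hn : 0 < n) (hR : 0 < R) (α : ℝ) :
    0 ≤ n ^ 2 + R ^ 2 - 2 * n * R * Real.cos α := by
  nlinarith [Real.cos_le_one α, sq_nonneg (n - R), mul_pos hn hR]

lemma thirdSide_sq {n R : ℝ} (hn : 0 < n) (hR : 0 < R) (α : ℝ) :
    thirdSide n R α ^ 2 = n ^ 2 + R ^ 2 - 2 * n * R * Real.cos α :=
  Real.sq_sqrt (thirdSide_radicand_nonneg hn hR α)

lemma thirdSide_le {n R : ℝ} (hn : 0 < n) (hR : 0 < R) (α : ℝ) : thirdSide n R α ≤ n + R := by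
  refine Real.sqrt_le_iff.2 ⟨by positivity, ?_⟩
  nlinarith [Real.neg_one_le_cos α, mul_pos hn hR]

lemma abs_angle_sub_le {n R ℓ c α β : ℝ} (hn : 0 < n) (hR : 0 < R) (hℓ : 0 ≤ ℓ)
    (hα : α ∈ Set.Icc 0 Real.pi) (hβ : β ∈ Set.Icc 0 Real.pi)
    (h1 : |thirdSide n R α - c| ≤ ℓ) (h2 : |thirdSide n R β - c| ≤ ℓ) :
    |α - β| ≤ Real.pi * √(2 * ℓ / min n R) := by
  have hpi := Real.pi_pos
  have hmin : 0 < min n R := lt_min hn hR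
  have hcos := abs_cos_sub_cos_ge hα hβ
  have hmm : |thirdSide n R α - thirdSide n R β| ≤ 2 * ℓ := by
    rw [abs_le] at *; constructor <;> linarith [h1.1, h1.2, h2.1, h2.2]
  have hsum : thirdSide n R α + thirdSide n R β ≤ 4 * max n R := by
    linarith [thirdSide_le hn hR α, thirdSide_le hn hR β, le_max_left n R, le_max_right n R]
  have hsum0 : 0 ≤ thirdSide n R α + thirdSide n R β := add_nonneg (Real.sqrt_nonneg _) (Real.sqrt_nonneg _)
  have key : 2 * (n * R) * |Real.cos α - Real.cos β| ≤ 2 * ℓ * (4 * max n R) := by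
    calc _ = |thirdSide n R α - thirdSide n R β| * (thirdSide n R α + thirdSide n R β) := by
          rw [← abs_of_nonneg hsum0, ← abs_mul,
            show 2 * (n * R) = |2 * (n * R)| from (abs_of_pos (by positivity)).symm, ← abs_mul,
            show (thirdSide n R α - thirdSide n R β) * (thirdSide n R α + thirdSide n R β) =
              -(2 * (n * R) * (Real.cos α - Real.cos β)) by
                linear_combination thirdSide_sq hn hR α - thirdSide_sq hn hR β, abs_neg]
      _ ≤ _ := by gcongr
  have hmm2 : n * R = min n R * max n R := (min_mul_max n R).symm
  have hmax : 0 < max n R := lt_max_of_lt_left hn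
  have h4 : min n R * |Real.cos α - Real.cos β| ≤ 4 * ℓ := by
    rw [hmm2] at key
    nlinarith
  have h5 : ((α - β) / Real.pi) ^ 2 ≤ 2 * ℓ / min n R := by
    rw [le_div_iff₀ hmin]
    nlinarith
  have h6 := Real.abs_le_sqrt h5
  rwa [abs_div, abs_of_pos hpi, div_le_iff₀ hpi, mul_comm] at h6

lemma volume_angle_le {n R ℓ : ℝ} (c : ℝ) (hn : 0 < n) (hR : 0 < R) (hℓ : 0 ≤ ℓ) :
    volume {α ∈ Set.Ioo (-Real.pi) Real.pi | |thirdSide n R α - c| ≤ ℓ} ≤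
      ENNReal.ofReal (2 * Real.pi * √(2 * ℓ / min n R)) := by
  have hpi := Real.pi_pos
  set D := Real.pi * √(2 * ℓ / min n R) with hD
  have hD0 : 0 ≤ D := by positivity
  let S : Set ℝ := {α | α ∈ Set.Icc 0 Real.pi ∧ |thirdSide n R α - c| ≤ ℓ}
  have hS : volume S ≤ ENNReal.ofReal D := by
    refine (Real.volume_le_diam S).trans (Metric.ediam_le fun x hx y hy => ?_)
    rw [edist_dist, Real.dist_eq]
    exact ENNReal.ofReal_le_ofReal (abs_angle_sub_le hn hR hℓ hx.1 hy.1 hx.2 hy.2)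
  have hsub : {α ∈ Set.Ioo (-Real.pi) Real.pi | |thirdSide n R α - c| ≤ ℓ} ⊆ S ∪ -S := by
    rintro α ⟨⟨h1, h2⟩, h3⟩
    rcases le_total 0 α with h | h
    · exact Or.inl ⟨⟨h, h2.le⟩, h3⟩
    · refine Or.inr ⟨⟨by linarith, by linarith⟩, ?_⟩
      rwa [thirdSide, Real.cos_neg]
  calc _ ≤ volume (S ∪ -S) := measure_mono hsub
    _ ≤ volume S + volume (-S) := measure_union_le _ _
    _ ≤ ENNReal.ofReal D + ENNReal.ofReal D := by
        rw [Measure.measure_neg]; gcongr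
    _ = _ := by rw [← ENNReal.ofReal_add hD0 hD0]; congr 1; rw [hD]; ring

lemma exists_isometry_map_norm (v : E2) (hv : v ≠ 0) :
    ∃ U : ℂ ≃ₗᵢ[ℝ] E2, U ((‖v‖ : ℝ) : ℂ) = v := by
  let V : ℂ ≃ₗᵢ[ℝ] E2 := Complex.isometryOfOrthonormal (EuclideanSpace.basisFun (Fin 2) ℝ)
  have hv' : ((‖v‖ : ℝ) : ℂ) ≠ 0 := by simpa using hv
  let a : Circle := ⟨V.symm v / ((‖v‖ : ℝ) : ℂ), by
    rw [Submonoid.unitSphere, ← SetLike.mem_coe]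
    simp [hv]⟩
  refine ⟨(rotation a).trans V, ?_⟩
  have : rotation a ((‖v‖ : ℝ) : ℂ) = V.symm v := by
    rw [rotation_apply]; exact div_mul_cancel₀ _ hv'
  simp [this]

lemma lintegral_norm_norm_sub (v : E2) (hv : v ≠ 0) (f : ℝ → ℝ → ENNReal) :
    ∫⁻ x : E2, f ‖x‖ ‖x - v‖ = ∫⁻ p in Set.Ioi (0 : ℝ) ×ˢ Set.Ioo (-Real.pi) Real.pi,
      ENNReal.ofReal p.1 * f p.1 (thirdSide p.1 ‖v‖ p.2) := by
  obtain ⟨U, hU⟩ := exists_isometry_map_norm v hv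
  rw [← (U.measurePreserving).lintegral_comp_emb U.toHomeomorph.measurableEmbedding,
    ← Complex.lintegral_comp_polarCoord_symm, polarCoord_target]
  refine setLIntegral_congr_fun (measurableSet_Ioi.prod measurableSet_Ioo) fun p hp => ?_
  have hp0 : 0 < p.1 := hp.1
  have h1 : ‖U (Complex.polarCoord.symm p)‖ = p.1 := by
    rw [U.norm_map, Complex.norm_polarCoord_symm, abs_of_pos hp0]
  have h2 : ‖U (Complex.polarCoord.symm p) - v‖ = thirdSide p.1 ‖v‖ p.2 := by
    nth_rw 1 [← hU]
    rw [← map_sub, U.norm_map, Complex.polarCoord_symm_apply, thirdSide, Complex.norm_def]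
    congr 1
    simp only [Complex.normSq_apply, sub_re, mul_re, ofReal_re, add_re, I_re, ofReal_im, I_im, sub_im,
      mul_im, add_im]
    linear_combination (p.1 ^ 2) * Real.sin_sq_add_cos_sq p.2
  simp only [smul_eq_mul, h1, h2]

lemma volume_slice_le (a b c ℓ₁ ℓ₂ n m : ℝ) (hb : b = 1 ∨ b = -1) (g : ENNReal) :
    ∫⁻ t : ℝ, {t : ℝ | |t + a * n| ≤ ℓ₁ ∧ |t - c + b * m| ≤ ℓ₂}.indicator (fun _ => g) t ≤
      ENNReal.ofReal (2 * min ℓ₁ ℓ₂) *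
        {m | |m - b * (c + a * n)| ≤ ℓ₁ + ℓ₂}.indicator (fun _ => g) m := by
  refine (lintegral_indicator_const_le _ _).trans ?_
  set S := {t : ℝ | |t + a * n| ≤ ℓ₁ ∧ |t - c + b * m| ≤ ℓ₂} with hS
  rcases Set.eq_empty_or_nonempty S with hemp | ⟨t, ht1, ht2⟩
  · simp [hemp]
  have hm : m ∈ {m | |m - b * (c + a * n)| ≤ ℓ₁ + ℓ₂} := by
    show |m - b * (c + a * n)| ≤ ℓ₁ + ℓ₂
    rw [abs_le] at *
    rcases hb with rfl | rfl <;> constructor <;> linarith [ht1.1, ht1.2, ht2.1, ht2.2]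
  rw [Set.indicator_of_mem hm, mul_comm]
  gcongr
  have h1 : volume S ≤ ENNReal.ofReal (2 * ℓ₁) := by
    refine (measure_mono fun t ht => ?_ : volume S ≤ volume (Set.Icc (-(a * n) - ℓ₁) (-(a * n) + ℓ₁))).trans ?_
    · have := abs_le.1 ht.1
      constructor <;> linarith [this.1, this.2]
    · rw [Real.volume_Icc]; apply ENNReal.ofReal_le_ofReal; linarith
  have h2 : volume S ≤ ENNReal.ofReal (2 * ℓ₂) := by
    refine (measure_mono fun t ht => ?_ : volume S ≤ volume (Set.Icc (c - b * m - ℓ₂) (c - b * m + ℓ₂))).trans ?_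
    · have := abs_le.1 ht.2
      constructor <;> linarith [this.1, this.2]
    · rw [Real.volume_Icc]; apply ENNReal.ofReal_le_ofReal; linarith
  rcases min_choice ℓ₁ ℓ₂ with h | h <;> rw [h] <;> assumption

lemma lintegral_norm_annulus_le {v : E2} (hv : v ≠ 0) {ℓ : ℝ} (hℓ : 0 ≤ ℓ) (c : ℝ → ℝ)
    (g : ℝ → ENNReal) :
    ∫⁻ x : E2, {m | |m - c ‖x‖| ≤ ℓ}.indicator (fun _ => g ‖x‖) ‖x - v‖ ≤
      ∫⁻ n in Set.Ioi (0 : ℝ), ENNReal.ofReal n * g n *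
        min (ENNReal.ofReal (2 * Real.pi)) (ENNReal.ofReal (2 * Real.pi * √(2 * ℓ / min n ‖v‖))) := by
  rw [lintegral_norm_norm_sub v hv (fun n m => {m | |m - c n| ≤ ℓ}.indicator (fun _ => g n) m),
    Measure.volume_eq_prod, ← Measure.prod_restrict]
  refine (lintegral_prod_le _).trans (setLIntegral_mono' measurableSet_Ioi fun n hn => ?_)
  have hR : 0 < ‖v‖ := norm_pos_iff.2 hv
  have heq : ∀ α : ℝ, ENNReal.ofReal n *
      {m | |m - c n| ≤ ℓ}.indicator (fun _ => g n) (thirdSide n ‖v‖ α) =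
      {α | |thirdSide n ‖v‖ α - c n| ≤ ℓ}.indicator (fun _ => ENNReal.ofReal n * g n) α := fun α => by
    simp only [Set.indicator_apply, Set.mem_ofPred_eq]
    split_ifs <;> simp
  simp only [heq]
  refine (lintegral_indicator_const_le _ _).trans ?_
  gcongr
  rw [Measure.restrict_apply' measurableSet_Ioo]
  refine le_min ?_ ?_
  · refine (measure_mono Set.inter_subset_right).trans ?_
    rw [Real.volume_Ioo]; apply ENNReal.ofReal_le_ofReal; linarith
  · refine le_trans (measure_mono ?_) (volume_angle_le (c n) hn hR hℓ)
    exact fun α h => ⟨h.2, h.1⟩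

lemma lintegral_two_cones_le {v : E2} (hv : v ≠ 0) {a b c ℓ₁ ℓ₂ : ℝ} (hb : b = 1 ∨ b = -1)
    (hℓ : 0 ≤ ℓ₁ + ℓ₂) (g : ℝ → ENNReal) :
    ∫⁻ y : SpaceTime, {y : SpaceTime | |y.1 + a * ‖y.2‖| ≤ ℓ₁ ∧
        |y.1 - c + b * ‖y.2 - v‖| ≤ ℓ₂}.indicator (fun y => g ‖y.2‖) y ≤
      ENNReal.ofReal (2 * min ℓ₁ ℓ₂) * ∫⁻ n in Set.Ioi (0 : ℝ), ENNReal.ofReal n * g n *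
        min (ENNReal.ofReal (2 * Real.pi))
          (ENNReal.ofReal (2 * Real.pi * √(2 * (ℓ₁ + ℓ₂) / min n ‖v‖))) := by
  rw [Measure.volume_eq_prod, ← lintegral_prod_swap]
  refine (lintegral_prod_le _).trans ?_
  refine le_trans ?_ (mul_le_mul_right
    (lintegral_norm_annulus_le hv hℓ (fun n => b * (c + a * n)) g) _)
  rw [← lintegral_const_mul' _ _ ENNReal.ofReal_ne_top]
  refine lintegral_mono fun x => ?_
  exact volume_slice_le a b c ℓ₁ ℓ₂ ‖x‖ ‖x - v‖ hb (g ‖x‖)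

/-- A weight `k` is dominated on `U` by a radial function whose weighted integral over the
intersection of two thickened cones is controlled by `D`. -/
def RadialBound {α : Type*} (U : Set α) (n k : α → ℝ) (R M D : ℝ) : Prop :=
  ∃ g : ℝ → ENNReal, (∀ y ∈ U, ENNReal.ofReal (k y) ≤ g (n y)) ∧
    ∫⁻ s in Set.Ioi (0 : ℝ), ENNReal.ofReal s * g s *
      min (ENNReal.ofReal (2 * Real.pi)) (ENNReal.ofReal (2 * Real.pi * √(4 * M / min s R))) ≤
        ENNReal.ofReal (26 * D)

lemma RadialBound.lintegral_le {U : Set SpaceTime} {k : SpaceTime → ℝ} {v : E2} {a b c ℓ₁ ℓ₂ M D μ : ℝ}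
    (h : RadialBound U (fun y => ‖y.2‖) k ‖v‖ M D) (hv : v ≠ 0) (hb : b = 1 ∨ b = -1)
    (hℓ₁ : 0 ≤ ℓ₁) (hℓ₂ : 0 ≤ ℓ₂) (hM₁ : ℓ₁ ≤ M) (hM₂ : ℓ₂ ≤ M) (hμ : min ℓ₁ ℓ₂ ≤ μ)
    (hU : ∀ y ∈ U, |y.1 + a * ‖y.2‖| ≤ ℓ₁ ∧ |y.1 - c + b * ‖y.2 - v‖| ≤ ℓ₂) :
    ∫⁻ y, U.indicator (fun y => ENNReal.ofReal (k y)) y ≤ ENNReal.ofReal (52 * (μ * D)) := by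
  obtain ⟨g, hg, hint⟩ := h
  have hμ0 : 0 ≤ μ := (le_min hℓ₁ hℓ₂).trans hμ
  calc _ ≤ _ := lintegral_mono (fun y => ?_)
    _ ≤ _ := lintegral_two_cones_le (a := a) (c := c) hv hb (add_nonneg hℓ₁ hℓ₂) g
    _ ≤ ENNReal.ofReal (2 * μ) * ENNReal.ofReal (26 * D) := by
        gcongr
        refine le_trans (setLIntegral_mono' measurableSet_Ioi fun s hs => ?_) hint
        have hmin : 0 < min s ‖v‖ := lt_min hs (norm_pos_iff.2 hv)
        have hM : 2 * (ℓ₁ + ℓ₂) ≤ 4 * M := by linarith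
        gcongr ENNReal.ofReal s * g s *
          min _ (ENNReal.ofReal (2 * Real.pi * √(?_ / _)))
    _ = _ := by rw [← ENNReal.ofReal_mul (by positivity)]; congr 1; ring
  by_cases hy : y ∈ U
  · have hy' : y ∈ {y : SpaceTime | |y.1 + a * ‖y.2‖| ≤ ℓ₁ ∧ |y.1 - c + b * ‖y.2 - v‖| ≤ ℓ₂} := hU y hy
    rw [Set.indicator_of_mem hy, Set.indicator_of_mem hy']
    exact hg y hy
  · simp [hy]

section RadialBound

variable {α : Type*} {U : Set α} {n k : α → ℝ} {R M D : ℝ}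

lemma RadialBound.of_flat (hR : 0 < R) (hM : 0 < M) (hn : ∀ y ∈ U, 0 < n y) (ρ Z W : ℝ) (hZ : 0 ≤ Z)
    (hW : 0 ≤ W) (hD : Z * W ≤ D)
    (h : ∀ y ∈ U, ρ ≤ n y ∧ n y ≤ ρ + W ∧ (k y * n y) ^ 2 * M ≤ Z ^ 2 * min (n y) R) :
    RadialBound U n k R M D := by
  have hpi := Real.pi_lt_d2
  have hpi0 := Real.pi_pos
  refine ⟨(Set.Icc ρ (ρ + W)).indicator fun s => ENNReal.ofReal (Z * √(min s R / M) / s),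
    fun y hy => ?_, ?_⟩
  · obtain ⟨h1, h2, h3⟩ := h y hy
    rw [Set.indicator_of_mem (show n y ∈ Set.Icc ρ (ρ + W) from ⟨h1, h2⟩)]
    apply ENNReal.ofReal_le_ofReal
    rw [le_div_iff₀ (hn y hy)]
    apply le_of_sq_le_sq _ (by positivity)
    have hmin : 0 < min (n y) R := lt_min (hn y hy) hR
    rw [mul_pow Z, Real.sq_sqrt (by positivity), ← mul_div_assoc, le_div_iff₀ hM]
    exact h3
  · calc _ ≤ ∫⁻ s in Set.Ioi (0 : ℝ), (Set.Icc ρ (ρ + W)).indicator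
          (fun _ => ENNReal.ofReal (4 * Real.pi * Z)) s := by
            refine setLIntegral_mono' measurableSet_Ioi fun s hs => ?_
            have hs : 0 < s := hs
            have hmin : 0 < min s R := lt_min hs hR
            refine (mul_le_mul_right (min_le_right _ _) _).trans ?_
            simp only [Set.indicator_apply]
            split_ifs
            · rw [← ENNReal.ofReal_mul hs.le, ← ENNReal.ofReal_mul (by positivity)]
              apply ENNReal.ofReal_le_ofReal
              have : √(min s R / M) * √(4 * M / min s R) = 2 := by
                rw [← Real.sqrt_mul (by positivity),
                  show min s R / M * (4 * M / min s R) = 2 ^ 2 by field_simp; norm_num]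
                exact Real.sqrt_sq (by norm_num)
              apply le_of_eq
              calc _ = 2 * Real.pi * Z * (√(min s R / M) * √(4 * M / min s R)) := by field_simp
                _ = _ := by rw [this]; ring
            · simp
      _ ≤ ∫⁻ s, (Set.Icc ρ (ρ + W)).indicator (fun _ => ENNReal.ofReal (4 * Real.pi * Z)) s :=
          setLIntegral_le_lintegral _ _
      _ = ENNReal.ofReal (4 * Real.pi * Z) * ENNReal.ofReal W := by
          rw [lintegral_indicator_const measurableSet_Icc, Real.volume_Icc]; congr 2; ring
      _ ≤ _ := by
          rw [← ENNReal.ofReal_mul (by positivity)]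
          apply ENNReal.ofReal_le_ofReal
          nlinarith [mul_nonneg hZ hW]

lemma RadialBound.of_trivial (hn : ∀ y ∈ U, 0 < n y) (ρ Z W : ℝ) (hZ : 0 ≤ Z)
    (hW : 0 ≤ W) (hD : Z * W ≤ D)
    (h : ∀ y ∈ U, ρ ≤ n y ∧ n y ≤ ρ + W ∧ k y * n y ≤ Z) :
    RadialBound U n k R M D := by
  have hpi := Real.pi_lt_d2
  have hpi0 := Real.pi_pos
  refine ⟨(Set.Icc ρ (ρ + W)).indicator fun s => ENNReal.ofReal (Z / s), fun y hy => ?_, ?_⟩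
  · obtain ⟨h1, h2, h3⟩ := h y hy
    rw [Set.indicator_of_mem (show n y ∈ Set.Icc ρ (ρ + W) from ⟨h1, h2⟩)]
    apply ENNReal.ofReal_le_ofReal
    rwa [le_div_iff₀ (hn y hy)]
  · calc _ ≤ ∫⁻ s in Set.Ioi (0 : ℝ), (Set.Icc ρ (ρ + W)).indicator
          (fun _ => ENNReal.ofReal (2 * Real.pi * Z)) s := by
            refine setLIntegral_mono' measurableSet_Ioi fun s hs => ?_
            have hs : 0 < s := hs
            refine (mul_le_mul_right (min_le_left _ _) _).trans ?_
            simp only [Set.indicator_apply]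
            split_ifs
            · rw [← ENNReal.ofReal_mul hs.le, ← ENNReal.ofReal_mul (by positivity)]
              apply ENNReal.ofReal_le_ofReal
              apply le_of_eq
              field_simp
            · simp
      _ ≤ ∫⁻ s, (Set.Icc ρ (ρ + W)).indicator (fun _ => ENNReal.ofReal (2 * Real.pi * Z)) s :=
          setLIntegral_le_lintegral _ _
      _ = ENNReal.ofReal (2 * Real.pi * Z) * ENNReal.ofReal W := by
          rw [lintegral_indicator_const measurableSet_Icc, Real.volume_Icc]; congr 2; ring
      _ ≤ _ := by
          rw [← ENNReal.ofReal_mul (by positivity)]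
          apply ENNReal.ofReal_le_ofReal
          nlinarith [mul_nonneg hZ hW]

lemma setLIntegral_rpow_neg_half {W : ℝ} (hW : 0 ≤ W) :
    ∫⁻ s in Set.Ioc 0 W, ENNReal.ofReal (s ^ (-(1 / 2) : ℝ)) = ENNReal.ofReal (2 * √W) := by
  have hi : IntervalIntegrable (fun s : ℝ => s ^ (-(1 / 2) : ℝ)) volume 0 W :=
    intervalIntegral.intervalIntegrable_rpow' (by norm_num)
  rw [← ofReal_integral_eq_lintegral_ofReal ((intervalIntegrable_iff_integrableOn_Ioc_of_le hW).1 hi),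
    ← intervalIntegral.integral_of_le hW, integral_rpow (Or.inl (by norm_num)), Real.sqrt_eq_rpow]
  · congr 1
    rw [Real.zero_rpow (by norm_num)]
    norm_num
    ring
  · filter_upwards [ae_restrict_mem measurableSet_Ioc] with s hs
    exact Real.rpow_nonneg hs.1.le _

lemma RadialBound.of_sqrt (hR : 0 < R) (hM : 0 < M) (hn : ∀ y ∈ U, 0 < n y) (Z W : ℝ) (hZ : 0 ≤ Z)
    (hW : 0 ≤ W) (hD : Z * √W ≤ D)
    (h : ∀ y ∈ U, n y ≤ W ∧ (k y * n y) ^ 2 * (n y * M) ≤ Z ^ 2 * min (n y) R) :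
    RadialBound U n k R M D := by
  have hpi := Real.pi_lt_d2
  have hpi0 := Real.pi_pos
  refine ⟨(Set.Iic W).indicator fun s => ENNReal.ofReal (Z * √(min s R / (s * M)) / s),
    fun y hy => ?_, ?_⟩
  · obtain ⟨h2, h3⟩ := h y hy
    have hny := hn y hy
    rw [Set.indicator_of_mem (show n y ∈ Set.Iic W from h2)]
    apply ENNReal.ofReal_le_ofReal
    rw [le_div_iff₀ (hn y hy)]
    apply le_of_sq_le_sq _ (by positivity)
    have hmin : 0 < min (n y) R := lt_min (hn y hy) hR
    rw [mul_pow Z, Real.sq_sqrt (by positivity), ← mul_div_assoc, le_div_iff₀ (by positivity)]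
    exact h3
  · calc _ ≤ ∫⁻ s in Set.Ioi (0 : ℝ), (Set.Iic W).indicator
          (fun s => ENNReal.ofReal (4 * Real.pi * Z) * ENNReal.ofReal (s ^ (-(1 / 2) : ℝ))) s := by
            refine setLIntegral_mono' measurableSet_Ioi fun s hs => ?_
            have hs : 0 < s := hs
            have hmin : 0 < min s R := lt_min hs hR
            refine (mul_le_mul_right (min_le_right _ _) _).trans ?_
            simp only [Set.indicator_apply]
            split_ifs
            · rw [← ENNReal.ofReal_mul hs.le, ← ENNReal.ofReal_mul (by positivity),
                ← ENNReal.ofReal_mul (by positivity)]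
              apply ENNReal.ofReal_le_ofReal
              have : √(min s R / (s * M)) * √(4 * M / min s R) = 2 * s ^ (-(1 / 2) : ℝ) := by
                rw [← Real.sqrt_mul (by positivity),
                  show min s R / (s * M) * (4 * M / min s R) = 2 ^ 2 * s⁻¹ by field_simp; norm_num,
                  Real.sqrt_mul (by norm_num), Real.sqrt_sq (by norm_num), Real.rpow_neg hs.le,
                  ← Real.sqrt_eq_rpow, Real.sqrt_inv]
              apply le_of_eq
              calc _ = 2 * Real.pi * Z * (√(min s R / (s * M)) * √(4 * M / min s R)) := by field_simp
                _ = _ := by rw [this]; ring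
            · simp
      _ = ENNReal.ofReal (4 * Real.pi * Z) * ENNReal.ofReal (2 * √W) := by
          rw [lintegral_indicator measurableSet_Iic, Measure.restrict_restrict measurableSet_Iic,
            lintegral_const_mul' _ _ ENNReal.ofReal_ne_top, ← setLIntegral_rpow_neg_half hW,
            Set.inter_comm, Set.Ioi_inter_Iic]
      _ ≤ _ := by
          rw [← ENNReal.ofReal_mul (by positivity)]
          apply ENNReal.ofReal_le_ofReal
          nlinarith [mul_nonneg hZ (Real.sqrt_nonneg W)]

end RadialBound

/-- Frequency pairs `(p, q)` with `p`, `p - q`, `q` at distance at most `L₁`, `L₂`, `L₀` from their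
light cones, and with nonzero spatial frequencies. -/
def modulationSet (s₁ s₂ s₃ L₁ L₂ L₀ : ℝ) : Set (SpaceTime × SpaceTime) :=
  {z | (0 < ‖z.1.2‖ ∧ 0 < ‖(z.1 - z.2).2‖ ∧ 0 < ‖z.2.2‖) ∧ |z.1.1 + s₁ * ‖z.1.2‖| ≤ L₁ ∧
    |(z.1 - z.2).1 + s₂ * ‖(z.1 - z.2).2‖| ≤ L₂ ∧ |z.2.1 + s₃ * ‖z.2.2‖| ≤ L₀}

/-- The angle between the signed spatial frequencies of `p` and `p - q`. -/
def freqAngle (s₁ s₂ : ℝ) (p q : SpaceTime) : ℝ := angOrZero (s₁ • p.2) (s₂ • (p - q).2)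

/-- The angle kernel, weighted by `|ξ|^{-1/2}` and restricted to `Ω`. -/
def angleKernel (s₁ s₂ : ℝ) (Ω : Set (SpaceTime × SpaceTime)) (p q : SpaceTime) : ENNReal :=
  Ω.indicator (fun z => ENNReal.ofReal (freqAngle s₁ s₂ z.1 z.2 / √‖z.2.2‖)) (p, q)

lemma measurable_angOrZero : Measurable fun z : E2 × E2 => angOrZero z.1 z.2 := by
  unfold angOrZero InnerProductGeometry.angle
  refine Measurable.ite ?_ measurable_const ?_
  · exact (measurable_fst (measurableSet_singleton 0)).union
      (measurable_snd (measurableSet_singleton 0))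
  · exact Real.continuous_arccos.measurable.comp ((measurable_fst.inner measurable_snd).div
      (measurable_fst.norm.mul measurable_snd.norm))

lemma measurable_freqAngle (s₁ s₂ : ℝ) :
    Measurable fun z : SpaceTime × SpaceTime => freqAngle s₁ s₂ z.1 z.2 :=
  measurable_angOrZero.comp ((measurable_fst.snd.const_smul s₁).prodMk
    ((measurable_fst.sub measurable_snd).snd.const_smul s₂))

lemma measurableSet_modulationSet (s₁ s₂ s₃ L₁ L₂ L₀ : ℝ) :
    MeasurableSet (modulationSet s₁ s₂ s₃ L₁ L₂ L₀) := by
  unfold modulationSet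
  measurability

lemma measurable_angleKernel (s₁ s₂ : ℝ) {Ω : Set (SpaceTime × SpaceTime)} (hΩ : MeasurableSet Ω) :
    Measurable (Function.uncurry (angleKernel s₁ s₂ Ω)) :=
  (((measurable_freqAngle s₁ s₂).div
    (Real.continuous_sqrt.measurable.comp measurable_snd.snd.norm)).ennreal_ofReal).indicator hΩ

lemma angOrZero_nonneg (a b : E2) : 0 ≤ angOrZero a b := by
  unfold angOrZero
  split_ifs
  exacts [le_rfl, InnerProductGeometry.angle_nonneg _ _]

lemma angOrZero_comm (a b : E2) : angOrZero a b = angOrZero b a := by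
  simp only [angOrZero, or_comm (a := a = 0), InnerProductGeometry.angle_comm a]

lemma angleKernel_sq (s₁ s₂ : ℝ) (Ω : Set (SpaceTime × SpaceTime)) (p q : SpaceTime) :
    angleKernel s₁ s₂ Ω p q ^ 2 =
      Ω.indicator (fun z => ENNReal.ofReal (freqAngle s₁ s₂ z.1 z.2 ^ 2 / ‖z.2.2‖)) (p, q) := by
  simp only [angleKernel, Set.indicator_apply]
  split_ifs
  · have h0 : 0 ≤ freqAngle s₁ s₂ p q := angOrZero_nonneg _ _
    rw [← ENNReal.ofReal_pow (div_nonneg h0 (Real.sqrt_nonneg _)), div_pow,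
      Real.sq_sqrt (norm_nonneg _)]
  · simp

lemma angleKernel_union_le (s₁ s₂ : ℝ) (Ω Ω₁ Ω₂ : Set (SpaceTime × SpaceTime)) (h : Ω ⊆ Ω₁ ∪ Ω₂)
    (p q : SpaceTime) :
    angleKernel s₁ s₂ Ω p q ≤ angleKernel s₁ s₂ Ω₁ p q + angleKernel s₁ s₂ Ω₂ p q := by
  simp only [angleKernel, Set.indicator_apply]
  by_cases h0 : (p, q) ∈ Ω
  · rcases h h0 with h1 | h1 <;> simp [h0, h1]
  · simp [h0]

lemma TriBounded.union {s₁ s₂ : ℝ} {Ω Ω₁ Ω₂ : Set (SpaceTime × SpaceTime)} {B₁ B₂ B : ℝ}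
    (hΩ₁ : MeasurableSet Ω₁) (h : Ω ⊆ Ω₁ ∪ Ω₂) (hB₁ : 0 ≤ B₁) (hB₂ : 0 ≤ B₂) (hB : B₁ + B₂ ≤ B)
    (h₁ : TriBounded (angleKernel s₁ s₂ Ω₁) (ENNReal.ofReal B₁))
    (h₂ : TriBounded (angleKernel s₁ s₂ Ω₂) (ENNReal.ofReal B₂)) :
    TriBounded (angleKernel s₁ s₂ Ω) (ENNReal.ofReal B) := by
  refine (h₁.add (measurable_angleKernel s₁ s₂ hΩ₁) h₂).mono (angleKernel_union_le s₁ s₂ _ _ _ h) ?_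
  rw [← ENNReal.ofReal_add hB₁ hB₂]
  exact ENNReal.ofReal_le_ofReal hB

lemma TriBounded.angleKernel_swap {s₁ s₂ : ℝ} {Ω : Set (SpaceTime × SpaceTime)} {B : ENNReal}
    (h : TriBounded (angleKernel s₂ s₁ ((fun z => (z.1 - z.2, -z.2)) ⁻¹' Ω)) B) :
    TriBounded (angleKernel s₁ s₂ Ω) B := by
  refine TriBounded.swap (h.mono (fun p q => le_of_eq ?_) le_rfl)
  simp only [angleKernel, Set.indicator_apply, Set.mem_preimage, freqAngle, sub_neg_eq_add,
    sub_add_cancel, Prod.snd_neg, norm_neg]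
  simp only [angOrZero_comm (s₁ • (p - q).2)]

section Duality

variable {s₁ s₂ s₃ L₁ L₂ L₀ : ℝ} {Ω : Set (SpaceTime × SpaceTime)} {M D μ B : ℝ}

lemma triBounded_angleKernel_of_fst (h₂ : s₂ = 1 ∨ s₂ = -1)
    (hΩ : MeasurableSet Ω) (hsub : Ω ⊆ modulationSet s₁ s₂ s₃ L₁ L₂ L₀) (hL₁ : 0 ≤ L₁) (hL₂ : 0 ≤ L₂)
    (hM₁ : L₁ ≤ M) (hM₂ : L₂ ≤ M) (hμ : min L₁ L₂ ≤ μ) (hB : 0 ≤ B) (hD : 52 * (μ * D) ≤ B ^ 2)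
    (h : ∀ q : SpaceTime, 0 < ‖q.2‖ → RadialBound {p | (p, q) ∈ Ω} (fun p => ‖p.2‖)
      (fun p => freqAngle s₁ s₂ p q ^ 2 / ‖q.2‖) ‖q.2‖ M D) :
    TriBounded (angleKernel s₁ s₂ Ω) (ENNReal.ofReal B) := by
  refine triBounded_of_fst (measurable_angleKernel s₁ s₂ hΩ) fun q => ?_
  rw [← ENNReal.ofReal_pow hB]
  simp only [angleKernel_sq]
  rcases eq_or_ne q.2 0 with hq | hq
  · have : ∀ p, (p, q) ∉ Ω := fun p hp => (hsub hp).1.2.2.ne' (by simp [hq])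
    simp [Set.indicator_of_notMem (this _)]
  refine le_trans ?_ (ENNReal.ofReal_le_ofReal hD)
  refine (h q (norm_pos_iff.2 hq)).lintegral_le hq h₂ hL₁ hL₂ hM₁ hM₂ hμ
    (a := s₁) (c := q.1) fun p hp => ?_
  exact ⟨(hsub hp).2.1, (hsub hp).2.2.1⟩

lemma triBounded_angleKernel_of_sub (h₃ : s₃ = 1 ∨ s₃ = -1)
    (hΩ : MeasurableSet Ω) (hsub : Ω ⊆ modulationSet s₁ s₂ s₃ L₁ L₂ L₀) (hL₁ : 0 ≤ L₁) (hL₀ : 0 ≤ L₀)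
    (hM₁ : L₁ ≤ M) (hM₀ : L₀ ≤ M) (hμ : min L₁ L₀ ≤ μ) (hB : 0 ≤ B) (hD : 52 * (μ * D) ≤ B ^ 2)
    (h : ∀ p' : SpaceTime, 0 < ‖p'.2‖ → RadialBound {p | (p, p - p') ∈ Ω} (fun p => ‖p.2‖)
      (fun p => freqAngle s₁ s₂ p (p - p') ^ 2 / ‖(p - p').2‖) ‖p'.2‖ M D) :
    TriBounded (angleKernel s₁ s₂ Ω) (ENNReal.ofReal B) := by
  refine triBounded_of_sub (measurable_angleKernel s₁ s₂ hΩ) fun p' => ?_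
  rw [← ENNReal.ofReal_pow hB]
  simp only [angleKernel_sq]
  rcases eq_or_ne p'.2 0 with hq | hq
  · have : ∀ p, (p, p - p') ∉ Ω := fun p hp => (hsub hp).1.2.1.ne' (by simp [hq])
    simp [Set.indicator_of_notMem (this _)]
  refine le_trans ?_ (ENNReal.ofReal_le_ofReal hD)
  refine (h p' (norm_pos_iff.2 hq)).lintegral_le hq h₃ hL₁ hL₀ hM₁ hM₀ hμ
    (a := s₁) (c := p'.1) fun p hp => ?_
  exact ⟨(hsub hp).2.1, (hsub hp).2.2.2⟩

lemma abs_sub_cone_comm {s : ℝ} (t c : ℝ) (x v : E2) :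
    |t - c + -s * ‖x - v‖| = |c - t + s * ‖v - x‖| := by
  rw [norm_sub_rev, ← abs_neg]; congr 1; ring

lemma triBounded_angleKernel_of_snd (h₂ : s₂ = 1 ∨ s₂ = -1)
    (hΩ : MeasurableSet Ω) (hsub : Ω ⊆ modulationSet s₁ s₂ s₃ L₁ L₂ L₀) (hL₀ : 0 ≤ L₀) (hL₂ : 0 ≤ L₂)
    (hM₀ : L₀ ≤ M) (hM₂ : L₂ ≤ M) (hμ : min L₀ L₂ ≤ μ) (hB : 0 ≤ B) (hD : 52 * (μ * D) ≤ B ^ 2)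
    (h : ∀ p : SpaceTime, 0 < ‖p.2‖ → RadialBound {q | (p, q) ∈ Ω} (fun q => ‖q.2‖)
      (fun q => freqAngle s₁ s₂ p q ^ 2 / ‖q.2‖) ‖p.2‖ M D) :
    TriBounded (angleKernel s₁ s₂ Ω) (ENNReal.ofReal B) := by
  refine triBounded_of_snd (measurable_angleKernel s₁ s₂ hΩ) fun p => ?_
  rw [← ENNReal.ofReal_pow hB]
  simp only [angleKernel_sq]
  rcases eq_or_ne p.2 0 with hq | hq
  · have : ∀ q, (p, q) ∉ Ω := fun q hp => (hsub hp).1.1.ne' (by simp [hq])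
    simp [Set.indicator_of_notMem (this _)]
  refine le_trans ?_ (ENNReal.ofReal_le_ofReal hD)
  refine (h p (norm_pos_iff.2 hq)).lintegral_le hq (b := -s₂) (by rcases h₂ with rfl | rfl <;> simp)
    hL₀ hL₂ hM₀ hM₂ hμ (a := s₃) (c := p.1) fun q hp => ?_
  exact ⟨(hsub hp).2.2.2, (abs_sub_cone_comm _ _ _ _).trans_le (hsub hp).2.2.1⟩

lemma triBounded_angleKernel_of_orthogonal (h₂ : s₂ = 1 ∨ s₂ = -1)
    (hΩ : MeasurableSet Ω) (hsub : Ω ⊆ modulationSet s₁ s₂ s₃ L₁ L₂ L₀) (hL₀ : 0 ≤ L₀) (hL₂ : 0 ≤ L₂)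
    (hM₀ : L₀ ≤ M) (hM₂ : L₂ ≤ M) (hμ : min L₀ L₂ ≤ μ) (hB : 0 ≤ B) (hD : 52 * (μ * D) ≤ B ^ 2)
    {N : ℝ} (hN : 0 < N) (hΩN : ∀ p q, (p, q) ∈ Ω → ‖p.2‖ ≤ N)
    (h : ∀ (s : ℝ) (p : SpaceTime), 0 < ‖p.2‖ →
      RadialBound {q | (p, q) ∈ Ω ∧ s ≤ ‖q.2‖ ∧ ‖q.2‖ ≤ s + N} (fun q => ‖q.2‖)
        (fun q => freqAngle s₁ s₂ p q ^ 2 / ‖q.2‖) ‖p.2‖ M D) :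
    TriBounded (angleKernel s₁ s₂ Ω) (ENNReal.ofReal (2 * B)) := by
  rw [ENNReal.ofReal_mul (by norm_num), ENNReal.ofReal_ofNat]
  refine triBounded_of_orthogonal (measurable_angleKernel s₁ s₂ hΩ) (ρ := fun q => ‖q.2‖)
    measurable_snd.norm hN (fun p q hK => ?_) fun s p => ?_
  · have hpq : (p, q) ∈ Ω := by
      by_contra hc
      exact hK (Set.indicator_of_notMem hc _)
    refine le_trans ?_ (hΩN p q hpq)
    have h1 := norm_sub_le p.2 q.2
    have h2 := norm_sub_norm_le q.2 p.2
    rw [norm_sub_rev] at h2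
    exact abs_le.2 ⟨by simp only [Prod.snd_sub]; linarith, by simp only [Prod.snd_sub]; linarith⟩
  rw [← ENNReal.ofReal_pow hB]
  rcases eq_or_ne p.2 0 with hq | hq
  · have : ∀ q, (p, q) ∉ Ω := fun q hp => (hsub hp).1.1.ne' (by simp [hq])
    simp [angleKernel, Set.indicator_of_notMem (this _)]
  refine le_trans ?_ (ENNReal.ofReal_le_ofReal hD)
  refine le_trans (le_of_eq (lintegral_congr fun q => ?_))
    ((h s p (norm_pos_iff.2 hq)).lintegral_le hq (b := -s₂) (by rcases h₂ with rfl | rfl <;> simp)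
    hL₀ hL₂ hM₀ hM₂ hμ (a := s₃) (c := p.1) fun q hp => ?_)
  · by_cases hs : s ≤ ‖q.2‖ ∧ ‖q.2‖ ≤ s + N
    · rw [Set.indicator_of_mem (s := {q : SpaceTime | _}) (by exact hs), angleKernel_sq]
      simp only [Set.indicator_apply, Set.mem_ofPred_eq, hs, and_true]
    · rw [Set.indicator_of_notMem (by exact hs), Set.indicator_of_notMem (fun hc => hs hc.2)]
      simp
  · exact ⟨(hsub hp.1).2.2.2, (abs_sub_cone_comm _ _ _ _).trans_le (hsub hp.1).2.2.1⟩

end Duality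

lemma one_sub_cos_ge {θ : ℝ} (h0 : 0 ≤ θ) (h1 : θ ≤ Real.pi) : θ ^ 2 / 5 ≤ 1 - Real.cos θ := by
  have h := Real.cos_le_one_sub_mul_cos_sq (x := θ) (by rwa [abs_of_nonneg h0])
  have hpi : Real.pi ^ 2 ≤ 10 := by nlinarith [Real.pi_lt_d2, Real.pi_pos]
  have : θ ^ 2 / 5 ≤ 2 / Real.pi ^ 2 * θ ^ 2 := by
    rw [div_eq_mul_inv, mul_comm]
    gcongr
    rw [le_div_iff₀ (by positivity)]
    linarith
  linarith

lemma freqAngle_sq_le_ten (s₁ s₂ : ℝ) (p q : SpaceTime) : freqAngle s₁ s₂ p q ^ 2 ≤ 10 := by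
  have h0 := angOrZero_nonneg (s₁ • p.2) (s₂ • (p - q).2)
  have h1 : freqAngle s₁ s₂ p q ≤ Real.pi := by
    unfold freqAngle angOrZero
    split_ifs
    exacts [Real.pi_pos.le, InnerProductGeometry.angle_le_pi _ _]
  have : 0 ≤ freqAngle s₁ s₂ p q := h0
  nlinarith [Real.pi_lt_d2, Real.pi_pos]

lemma freqAngle_law_of_cosines {s₁ s₂ : ℝ} (h₁ : s₁ = 1 ∨ s₁ = -1) (h₂ : s₂ = 1 ∨ s₂ = -1)
    {p q : SpaceTime} (hp : 0 < ‖p.2‖) (hpq : 0 < ‖(p - q).2‖) :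
    ‖q.2‖ ^ 2 = ‖p.2‖ ^ 2 + ‖(p - q).2‖ ^ 2 -
      2 * (s₁ * s₂) * (‖p.2‖ * ‖(p - q).2‖ * Real.cos (freqAngle s₁ s₂ p q)) := by
  have hs₁ : s₁ ≠ 0 := by rcases h₁ with rfl | rfl <;> norm_num
  have hs₂ : s₂ ≠ 0 := by rcases h₂ with rfl | rfl <;> norm_num
  have hss₁ : s₁ ^ 2 = 1 := by rcases h₁ with rfl | rfl <;> norm_num
  have hss₂ : s₂ ^ 2 = 1 := by rcases h₂ with rfl | rfl <;> norm_num
  have hn₁ : ‖s₁ • p.2‖ = ‖p.2‖ := by rcases h₁ with rfl | rfl <;> simp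
  have hn₂ : ‖s₂ • (p - q).2‖ = ‖(p - q).2‖ := by rcases h₂ with rfl | rfl <;> simp [norm_sub_rev]
  have hang : freqAngle s₁ s₂ p q = InnerProductGeometry.angle (s₁ • p.2) (s₂ • (p - q).2) := by
    rw [freqAngle, angOrZero, if_neg]
    push Not
    exact ⟨smul_ne_zero hs₁ (norm_pos_iff.1 hp), smul_ne_zero hs₂ (norm_pos_iff.1 hpq)⟩
  have hin := InnerProductGeometry.cos_angle_mul_norm_mul_norm (s₁ • p.2) (s₂ • (p - q).2)
  rw [← hang, hn₁, hn₂, real_inner_smul_left, real_inner_smul_right] at hin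
  have hq : q.2 = p.2 - (p - q).2 := by simp
  have := norm_sub_sq_real p.2 (p - q).2
  rw [← hq] at this
  rw [this]
  linear_combination 2 * (s₁ * s₂) * hin + 2 * ⟪p.2, (p - q).2⟫ * (s₂ ^ 2 * hss₁ + hss₂) * 1

section Facts

variable {s₁ s₂ s₃ L₁ L₂ L₀ L : ℝ} {p q : SpaceTime}

lemma freqAngle_sq_mul_le (h₁ : s₁ = 1 ∨ s₁ = -1) (h₂ : s₂ = 1 ∨ s₂ = -1)
    (hp : 0 < ‖p.2‖) (hpq : 0 < ‖(p - q).2‖) :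
    freqAngle s₁ s₂ p q ^ 2 * (‖p.2‖ * ‖(p - q).2‖) ≤
      5 / 2 * (s₁ * s₂ * (‖q.2‖ ^ 2 - (‖p.2‖ - s₁ * s₂ * ‖(p - q).2‖) ^ 2)) := by
  have hθ1 : freqAngle s₁ s₂ p q ≤ Real.pi := by
    unfold freqAngle angOrZero
    split_ifs
    exacts [Real.pi_pos.le, InnerProductGeometry.angle_le_pi _ _]
  have hcos : freqAngle s₁ s₂ p q ^ 2 / 5 ≤ 1 - Real.cos (freqAngle s₁ s₂ p q) :=
    one_sub_cos_ge (angOrZero_nonneg _ _) hθ1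
  have hlaw := freqAngle_law_of_cosines h₁ h₂ hp hpq
  have hσ : s₁ * s₂ = 1 ∨ s₁ * s₂ = -1 := by
    rcases h₁ with rfl | rfl <;> rcases h₂ with rfl | rfl <;> simp
  have hmul := mul_le_mul_of_nonneg_left hcos (mul_pos hp hpq).le
  rw [hlaw]
  rcases hσ with h | h <;> rw [h] <;> nlinarith

lemma modulationSet_resonance (h₁ : s₁ = 1 ∨ s₁ = -1) (h₂ : s₂ = 1 ∨ s₂ = -1)
    (h₃ : s₃ = 1 ∨ s₃ = -1) (h : (p, q) ∈ modulationSet s₁ s₂ s₃ L₁ L₂ L₀)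
    (hL₁ : L₁ ≤ L) (hL₂ : L₂ ≤ L) (hL₀ : L₀ ≤ L) :
    s₁ * s₂ * (‖q.2‖ - |‖p.2‖ - s₁ * s₂ * ‖(p - q).2‖|) ≤ 3 * L := by
  obtain ⟨⟨hn, hm, hr⟩, h1, h2, h3⟩ := h
  simp only [Prod.fst_sub] at h1 h2 h3
  rw [abs_le] at h1 h2 h3
  set n := ‖p.2‖
  set m := ‖(p - q).2‖
  set r := ‖q.2‖
  rcases h₁ with rfl | rfl <;> rcases h₂ with rfl | rfl <;> rcases h₃ with rfl | rfl <;>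
    rcases abs_cases (n - m) with ⟨ha, _⟩ | ⟨ha, _⟩ <;> norm_num <;> (try rw [ha]) <;>
    (try rw [abs_of_pos (add_pos hn hm)]) <;> linarith [h1.1, h1.2, h2.1, h2.2, h3.1, h3.2]

lemma freqAngle_sq_mul_min_le (h₁ : s₁ = 1 ∨ s₁ = -1) (h₂ : s₂ = 1 ∨ s₂ = -1)
    (h₃ : s₃ = 1 ∨ s₃ = -1) (h : (p, q) ∈ modulationSet s₁ s₂ s₃ L₁ L₂ L₀)
    (hL₁ : L₁ ≤ L) (hL₂ : L₂ ≤ L) (hL₀ : L₀ ≤ L) :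
    freqAngle s₁ s₂ p q ^ 2 * min ‖p.2‖ ‖(p - q).2‖ ≤ 30 * L := by
  have hres := modulationSet_resonance h₁ h₂ h₃ h hL₁ hL₂ hL₀
  have hL : 0 ≤ L := (abs_nonneg _).trans (h.2.1.trans hL₁)
  obtain ⟨⟨hn, hm, hr⟩, -⟩ := h
  have hmul := freqAngle_sq_mul_le h₁ h₂ hn hm
  have htri : ‖q.2‖ ≤ ‖p.2‖ + ‖(p - q).2‖ := by
    have := norm_sub_le p.2 (p - q).2; simpa using this
  have htri2 : |‖p.2‖ - ‖(p - q).2‖| ≤ ‖q.2‖ := by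
    have := abs_norm_sub_norm_le p.2 (p - q).2; simpa using this
  simp only at hn hm hr
  set n := ‖p.2‖
  set m := ‖(p - q).2‖
  set r := ‖q.2‖
  set Θ := freqAngle s₁ s₂ p q ^ 2
  have hmax : 0 < max n m := lt_max_of_lt_left hn
  have hsum : n + m ≤ 2 * max n m := by linarith [le_max_left n m, le_max_right n m]
  have key : s₁ * s₂ * (r ^ 2 - (n - s₁ * s₂ * m) ^ 2) ≤ 12 * L * max n m := by
    have hfac : s₁ * s₂ * (r ^ 2 - (n - s₁ * s₂ * m) ^ 2) =
        s₁ * s₂ * (r - |n - s₁ * s₂ * m|) * (r + |n - s₁ * s₂ * m|) := by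
      rw [← sq_abs (n - s₁ * s₂ * m)]; ring
    have habs : |n - s₁ * s₂ * m| ≤ n + m := by
      rcases h₁ with rfl | rfl <;> rcases h₂ with rfl | rfl <;> norm_num <;>
        refine abs_le.2 ⟨by linarith, by linarith⟩
    rw [hfac]
    calc _ ≤ 3 * L * (r + |n - s₁ * s₂ * m|) := by gcongr
      _ ≤ 3 * L * (4 * max n m) := by gcongr; linarith
      _ = _ := by ring
  have h6 : Θ * (min n m * max n m) ≤ 30 * L * max n m := by
    rw [min_mul_max]; linarith
  rw [← mul_assoc] at h6
  exact le_of_mul_le_mul_right h6 hmax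

end Facts

/-- The relations between `n = |η|`, `m = |η - ξ|`, `r = |ξ|` and the squared angle `Θ` which hold on
a modulation set with sign product `σ` and largest modulation `L`. -/
structure AngleRelations (σ L n m r Θ : ℝ) : Prop where
  n_pos : 0 < n
  m_pos : 0 < m
  r_pos : 0 < r
  r_le : r ≤ n + m
  n_le : n ≤ m + r
  m_le : m ≤ n + r
  sq_nonneg : 0 ≤ Θ
  sq_le : Θ ≤ 10
  sq_mul_min_le : Θ * min n m ≤ 30 * L
  sq_mul_mul_le : σ = 1 → Θ * (n * m) ≤ 5 / 2 * r ^ 2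
  add_le : σ = -1 → n + m - r ≤ 3 * L

lemma AngleRelations.of_mem {s₁ s₂ s₃ L₁ L₂ L₀ L : ℝ} {p q : SpaceTime} (h₁ : s₁ = 1 ∨ s₁ = -1)
    (h₂ : s₂ = 1 ∨ s₂ = -1) (h₃ : s₃ = 1 ∨ s₃ = -1)
    (h : (p, q) ∈ modulationSet s₁ s₂ s₃ L₁ L₂ L₀)
    (hL₁ : L₁ ≤ L) (hL₂ : L₂ ≤ L) (hL₀ : L₀ ≤ L) :
    AngleRelations (s₁ * s₂) L ‖p.2‖ ‖(p - q).2‖ ‖q.2‖ (freqAngle s₁ s₂ p q ^ 2) where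
  n_pos := h.1.1
  m_pos := h.1.2.1
  r_pos := h.1.2.2
  r_le := by simpa using norm_sub_le p.2 (p - q).2
  n_le := by simpa using norm_add_le (p - q).2 q.2
  m_le := by simpa using norm_sub_le p.2 q.2
  sq_nonneg := _root_.sq_nonneg _
  sq_le := freqAngle_sq_le_ten _ _ _ _
  sq_mul_min_le := freqAngle_sq_mul_min_le h₁ h₂ h₃ h hL₁ hL₂ hL₀
  sq_mul_mul_le hσ := by
    have := freqAngle_sq_mul_le h₁ h₂ h.1.1 h.1.2.1
    rw [hσ] at this
    nlinarith [_root_.sq_nonneg (‖p.2‖ - ‖(p - q).2‖)]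
  add_le hσ := by
    have := modulationSet_resonance h₁ h₂ h₃ h hL₁ hL₂ hL₀
    rw [hσ, abs_of_pos (by linarith [h.1.1, h.1.2.1] : 0 < ‖p.2‖ - -1 * ‖(p - q).2‖)] at this
    linarith

lemma min_pow_six_le (a b : ℝ) : min (a ^ 6) (b ^ 6) ≤ min a b ^ 6 := by
  rcases le_total a b with h | h
  · rw [min_eq_left h]; exact min_le_left _ _
  · rw [min_eq_right h]; exact min_le_right _ _

lemma pow_six_le_max_left {a b : ℝ} (ha : 0 < a) : a ^ 6 ≤ max a b ^ 6 := by
  gcongr; exact le_max_left _ _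

lemma pow_six_le_max_right {a b : ℝ} (hb : 0 < b) : b ^ 6 ≤ max a b ^ 6 := by
  gcongr; exact le_max_right _ _

/-- The trilinear form with angle kernel is bounded by `B` on every part of the modulation set with
modulations `l₁ ^ 6`, `l₂ ^ 6`, `l₀ ^ 6` on which the sizes of the spatial frequencies satisfy `P`. -/
def RegionBounded (s₁ s₂ s₃ l₁ l₂ l₀ : ℝ) (P : ℝ → ℝ → ℝ → Prop) (B : ℝ) : Prop :=
  ∀ Ω : Set (SpaceTime × SpaceTime), MeasurableSet Ω →
    Ω ⊆ modulationSet s₁ s₂ s₃ (l₁ ^ 6) (l₂ ^ 6) (l₀ ^ 6) →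
    (∀ z ∈ Ω, P ‖z.1.2‖ ‖(z.1 - z.2).2‖ ‖z.2.2‖) → TriBounded (angleKernel s₁ s₂ Ω) (ENNReal.ofReal B)

section Region

variable {s₁ s₂ s₃ l₁ l₂ l₀ : ℝ} {P Q : ℝ → ℝ → ℝ → Prop} {B B₁ B₂ l D : ℝ}

lemma RegionBounded.mono (h : RegionBounded s₁ s₂ s₃ l₁ l₂ l₀ Q B₁) (hP : ∀ n m r, P n m r → Q n m r)
    (hB : B₁ ≤ B) : RegionBounded s₁ s₂ s₃ l₁ l₂ l₀ P B := fun Ω hΩ hsub hz =>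
  (h Ω hΩ hsub fun z hzΩ => hP _ _ _ (hz z hzΩ)).mono (fun _ _ => le_rfl) (ENNReal.ofReal_le_ofReal hB)

lemma RegionBounded.split (f g : ℝ → ℝ → ℝ → ℝ) (hf : Continuous fun x : ℝ × ℝ × ℝ => f x.1 x.2.1 x.2.2)
    (hg : Continuous fun x : ℝ × ℝ × ℝ => g x.1 x.2.1 x.2.2) (hB₁ : 0 ≤ B₁) (hB₂ : 0 ≤ B₂)
    (hB : B₁ + B₂ ≤ B)
    (h₁ : RegionBounded s₁ s₂ s₃ l₁ l₂ l₀ (fun n m r => P n m r ∧ f n m r ≤ g n m r) B₁)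
    (h₂ : RegionBounded s₁ s₂ s₃ l₁ l₂ l₀ (fun n m r => P n m r ∧ g n m r ≤ f n m r) B₂) :
    RegionBounded s₁ s₂ s₃ l₁ l₂ l₀ P B := by
  intro Ω hΩ hsub hz
  have hsize : Measurable fun z : SpaceTime × SpaceTime => (‖z.1.2‖, ‖(z.1 - z.2).2‖, ‖z.2.2‖) := by
    fun_prop
  have hm₁ := hΩ.inter (measurableSet_le (hf.measurable.comp hsize) (hg.measurable.comp hsize))
  have hm₂ := hΩ.inter (measurableSet_le (hg.measurable.comp hsize) (hf.measurable.comp hsize))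
  refine TriBounded.union hm₁ (fun z hzΩ => ?_) hB₁ hB₂ hB
    (h₁ _ hm₁ (Set.inter_subset_left.trans hsub) fun z hzΩ => ⟨hz z hzΩ.1, hzΩ.2⟩)
    (h₂ _ hm₂ (Set.inter_subset_left.trans hsub) fun z hzΩ => ⟨hz z hzΩ.1, hzΩ.2⟩)
  rcases le_total (f ‖z.1.2‖ ‖(z.1 - z.2).2‖ ‖z.2.2‖) (g ‖z.1.2‖ ‖(z.1 - z.2).2‖ ‖z.2.2‖) with h | h
  exacts [Or.inl ⟨hzΩ, h⟩, Or.inr ⟨hzΩ, h⟩]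

lemma RegionBounded.swap
    (h : RegionBounded s₂ s₁ (-s₃) l₂ l₁ l₀ (fun n m r => P m n r) B) :
    RegionBounded s₁ s₂ s₃ l₁ l₂ l₀ P B := by
  intro Ω hΩ hsub hz
  refine TriBounded.angleKernel_swap (h _ ?_ ?_ ?_)
  · exact ((measurable_fst.sub measurable_snd).prodMk measurable_snd.neg) hΩ
  · rintro ⟨p, q⟩ hpq
    obtain ⟨⟨hn, hm, hr⟩, h1, h2, h3⟩ := hsub hpq
    simp only [sub_neg_eq_add, sub_add_cancel, Prod.snd_neg, norm_neg, Prod.fst_neg] at hn hm hr h1 h2 h3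
    refine ⟨⟨hm, hn, hr⟩, h2, h1, ?_⟩
    rw [← abs_neg]
    convert h3 using 2
    ring
  · rintro ⟨p, q⟩ hpq
    simpa using hz _ hpq

variable (h₁ : s₁ = 1 ∨ s₁ = -1) (h₂ : s₂ = 1 ∨ s₂ = -1) (h₃ : s₃ = 1 ∨ s₃ = -1)
  (hl₁ : 0 < l₁) (hl₂ : 0 < l₂) (hl₀ : 0 < l₀) (hl : l₁ ≤ l ∧ l₂ ≤ l ∧ l₀ ≤ l)

include h₁ h₂ h₃ hl₁ hl₂ hl₀ hl in
lemma AngleRelations.of_mem_pow {p q : SpaceTime}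
    (h : (p, q) ∈ modulationSet s₁ s₂ s₃ (l₁ ^ 6) (l₂ ^ 6) (l₀ ^ 6)) :
    AngleRelations (s₁ * s₂) (l ^ 6) ‖p.2‖ ‖(p - q).2‖ ‖q.2‖ (freqAngle s₁ s₂ p q ^ 2) :=
  .of_mem h₁ h₂ h₃ h (pow_le_pow_left₀ hl₁.le hl.1 6) (pow_le_pow_left₀ hl₂.le hl.2.1 6)
    (pow_le_pow_left₀ hl₀.le hl.2.2 6)

include h₂ hl₁ hl₂ in
lemma RegionBounded.of_radial_fst (hB : 0 ≤ B) (hD : 52 * (min l₁ l₂ ^ 6 * D) ≤ B ^ 2)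
    (h : ∀ q : SpaceTime, 0 < ‖q.2‖ → RadialBound
      {p | (p, q) ∈ modulationSet s₁ s₂ s₃ (l₁ ^ 6) (l₂ ^ 6) (l₀ ^ 6) ∧ P ‖p.2‖ ‖(p - q).2‖ ‖q.2‖}
      (fun p => ‖p.2‖) (fun p => freqAngle s₁ s₂ p q ^ 2 / ‖q.2‖) ‖q.2‖ (max l₁ l₂ ^ 6) D) :
    RegionBounded s₁ s₂ s₃ l₁ l₂ l₀ P B := by
  intro Ω hΩ hsub hz
  refine triBounded_angleKernel_of_fst h₂ hΩ hsub (by positivity) (by positivity)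
    (pow_six_le_max_left hl₁) (pow_six_le_max_right hl₂) (min_pow_six_le _ _) hB hD fun q hq => ?_
  obtain ⟨g, hg, hint⟩ := h q hq
  refine ⟨g, fun p hp => ?_, hint⟩
  have hpq : (p, q) ∈ Ω := hp
  exact hg p ⟨hsub hpq, hz (p, q) hpq⟩

include h₁ h₂ h₃ hl₁ hl₂ hl₀ hl in
lemma RegionBounded.of_fst (hB : 0 ≤ B) (hD : 52 * (min l₁ l₂ ^ 6 * D) ≤ B ^ 2)
    (h : ∀ r : ℝ, 0 < r → RadialBound
      {x : ℝ × ℝ × ℝ | AngleRelations (s₁ * s₂) (l ^ 6) x.1 x.2.1 r x.2.2 ∧ P x.1 x.2.1 r}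
      (fun x => x.1) (fun x => x.2.2 / r) r (max l₁ l₂ ^ 6) D) :
    RegionBounded s₁ s₂ s₃ l₁ l₂ l₀ P B :=
  .of_radial_fst h₂ hl₁ hl₂ hB hD fun q hq => by
    obtain ⟨g, hg, hint⟩ := h _ hq
    exact ⟨g, fun p hp => hg (‖p.2‖, ‖(p - q).2‖, freqAngle s₁ s₂ p q ^ 2)
      ⟨.of_mem_pow h₁ h₂ h₃ hl₁ hl₂ hl₀ hl hp.1, hp.2⟩, hint⟩

include h₁ h₂ h₃ hl₁ hl₂ hl₀ hl in
lemma RegionBounded.of_sub (hB : 0 ≤ B) (hD : 52 * (min l₁ l₀ ^ 6 * D) ≤ B ^ 2)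
    (h : ∀ m : ℝ, 0 < m → RadialBound
      {x : ℝ × ℝ × ℝ | AngleRelations (s₁ * s₂) (l ^ 6) x.1 m x.2.1 x.2.2 ∧ P x.1 m x.2.1}
      (fun x => x.1) (fun x => x.2.2 / x.2.1) m (max l₁ l₀ ^ 6) D) :
    RegionBounded s₁ s₂ s₃ l₁ l₂ l₀ P B := by
  intro Ω hΩ hsub hz
  refine triBounded_angleKernel_of_sub h₃ hΩ hsub (by positivity) (by positivity)
    (pow_six_le_max_left hl₁) (pow_six_le_max_right hl₀) (min_pow_six_le _ _) hB hD fun p' hp' => ?_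
  obtain ⟨g, hg, hint⟩ := h _ hp'
  refine ⟨g, fun p hp => hg (‖p.2‖, ‖(p - p').2‖, freqAngle s₁ s₂ p (p - p') ^ 2) ?_, hint⟩
  have hrel := AngleRelations.of_mem_pow h₁ h₂ h₃ hl₁ hl₂ hl₀ hl (hsub hp)
  have hP := hz _ hp
  simp only [sub_sub_cancel] at hrel hP
  exact ⟨hrel, hP⟩

include h₁ h₂ h₃ hl₁ hl₂ hl₀ hl in
lemma RegionBounded.of_snd (hB : 0 ≤ B) (hD : 52 * (min l₀ l₂ ^ 6 * D) ≤ B ^ 2)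
    (h : ∀ n : ℝ, 0 < n → RadialBound
      {x : ℝ × ℝ × ℝ | AngleRelations (s₁ * s₂) (l ^ 6) n x.1 x.2.1 x.2.2 ∧ P n x.1 x.2.1}
      (fun x => x.2.1) (fun x => x.2.2 / x.2.1) n (max l₀ l₂ ^ 6) D) :
    RegionBounded s₁ s₂ s₃ l₁ l₂ l₀ P B := by
  intro Ω hΩ hsub hz
  refine triBounded_angleKernel_of_snd h₂ hΩ hsub (by positivity) (by positivity)
    (pow_six_le_max_left hl₀) (pow_six_le_max_right hl₂) (min_pow_six_le _ _) hB hD fun p hp => ?_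
  obtain ⟨g, hg, hint⟩ := h _ hp
  refine ⟨g, fun q hq => ?_, hint⟩
  have hpq : (p, q) ∈ Ω := hq
  exact hg (‖(p - q).2‖, ‖q.2‖, freqAngle s₁ s₂ p q ^ 2)
    ⟨.of_mem_pow h₁ h₂ h₃ hl₁ hl₂ hl₀ hl (hsub hpq), hz (p, q) hpq⟩

include h₁ h₂ h₃ hl₁ hl₂ hl₀ hl in
lemma RegionBounded.of_orthogonal (hB : 0 ≤ B) (hD : 52 * (min l₀ l₂ ^ 6 * D) ≤ B ^ 2) {N : ℝ}
    (hN : 0 < N) (hPN : ∀ n m r, P n m r → n ≤ N)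
    (h : ∀ s n : ℝ, 0 < n → RadialBound
      {x : ℝ × ℝ × ℝ | (AngleRelations (s₁ * s₂) (l ^ 6) n x.1 x.2.1 x.2.2 ∧ P n x.1 x.2.1) ∧
        s ≤ x.2.1 ∧ x.2.1 ≤ s + N}
      (fun x => x.2.1) (fun x => x.2.2 / x.2.1) n (max l₀ l₂ ^ 6) D) :
    RegionBounded s₁ s₂ s₃ l₁ l₂ l₀ P (2 * B) := by
  intro Ω hΩ hsub hz
  refine triBounded_angleKernel_of_orthogonal h₂ hΩ hsub (by positivity) (by positivity)
    (pow_six_le_max_left hl₀) (pow_six_le_max_right hl₂) (min_pow_six_le _ _) hB hD hN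
    (fun p q hpq => hPN _ _ _ (hz (p, q) hpq)) fun s p hp => ?_
  obtain ⟨g, hg, hint⟩ := h s _ hp
  refine ⟨g, fun q hq => ?_, hint⟩
  have hpq : (p, q) ∈ Ω := hq.1
  exact hg (‖(p - q).2‖, ‖q.2‖, freqAngle s₁ s₂ p q ^ 2)
    ⟨⟨.of_mem_pow h₁ h₂ h₃ hl₁ hl₂ hl₀ hl (hsub hpq), hz (p, q) hpq⟩, hq.2⟩

end Region

section Pieces

lemma six_mul_cube_le {x y z : ℝ} (hx : 0 < x) (hxy : x ≤ y) (hxz : x ≤ z) :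
    52 * (x ^ 6 * (140 * (z * y) ^ 3)) ≤ (200 * (z * (x * y)) ^ 2) ^ 2 := by
  have hy : 0 < y := hx.trans_le hxy
  have hz : 0 < z := hx.trans_le hxz
  have h : x * x ≤ z * y := mul_le_mul hxz hxy hx.le hz.le
  calc 52 * (x ^ 6 * (140 * (z * y) ^ 3)) = 7280 * (x ^ 4 * (z * y) ^ 3) * (x * x) := by ring
    _ ≤ 40000 * (x ^ 4 * (z * y) ^ 3) * (z * y) := by gcongr; norm_num
    _ = _ := by ring

lemma six_mul_four_two_le {x y z : ℝ} (hx : 0 < x) (hxy : x ≤ y) (hz : 0 < z) :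
    52 * (x ^ 6 * (240 * (z ^ 4 * y ^ 2))) ≤ (200 * (z * (x * y)) ^ 2) ^ 2 := by
  have hy : 0 < y := hx.trans_le hxy
  have h : x * x ≤ y * y := mul_le_mul hxy hxy hx.le hy.le
  calc 52 * (x ^ 6 * (240 * (z ^ 4 * y ^ 2))) = 12480 * (x ^ 4 * z ^ 4 * y ^ 2) * (x * x) := by ring
    _ ≤ 40000 * (x ^ 4 * z ^ 4 * y ^ 2) * (y * y) := by gcongr; norm_num
    _ = _ := by ring

lemma AngleRelations.mul_le {σ L n m r Θ : ℝ} (h : AngleRelations σ L n m r Θ) (hnm : n ≤ m) :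
    Θ * n ≤ 30 * L := by
  simpa [min_eq_left hnm] using h.sq_mul_min_le

lemma AngleRelations.mul_sq_le {σ L n m r Θ : ℝ} (h : AngleRelations σ L n m r Θ) (hnm : n ≤ m) :
    (Θ * n) ^ 2 ≤ 300 * L * n := by
  have h1 := h.mul_le hnm
  have h2 : Θ * n ≤ 10 * n := mul_le_mul_of_nonneg_right h.sq_le h.n_pos.le
  have h3 : 0 ≤ Θ * n := mul_nonneg h.sq_nonneg h.n_pos.le
  nlinarith [mul_le_mul h1 h2 h3 (h3.trans h1)]

lemma AngleRelations.le_four_mul_min {σ L n m r Θ : ℝ} (h : AngleRelations σ L n m r Θ) (hnm : n ≤ m)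
    (hmr : m ≤ 4 * r) : n ≤ 4 * min n r := by
  have := h.n_pos
  rcases min_cases n r with ⟨h1, _⟩ | ⟨h1, _⟩ <;> rw [h1] <;> linarith

variable {s₁ s₂ s₃ l₁ l₂ l₀ : ℝ} (h₁ : s₁ = 1 ∨ s₁ = -1) (h₂ : s₂ = 1 ∨ s₂ = -1)
  (h₃ : s₃ = 1 ∨ s₃ = -1) (hl₁ : 0 < l₁) (hl₂ : 0 < l₂) (hl₀ : 0 < l₀)

include h₁ h₂ h₃ hl₁ hl₂ hl₀

lemma regionBounded_near_of_le_zero (h10 : l₁ ≤ l₀) (h20 : l₂ ≤ l₀) :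
    RegionBounded s₁ s₂ s₃ l₁ l₂ l₀ (fun n m r => n ≤ m ∧ m ≤ 4 * r)
      (200 * (l₀ * (l₁ * l₂)) ^ 2) := by
  refine .of_fst (l := l₀) h₁ h₂ h₃ hl₁ hl₂ hl₀ ⟨h10, h20, le_rfl⟩
    (D := 140 * (l₀ * max l₁ l₂) ^ 3) (by positivity) ?_ fun r hr => ?_
  · rw [← min_mul_max l₁ l₂]
    exact six_mul_cube_le (lt_min hl₁ hl₂) min_le_max ((min_le_left _ _).trans h10)
  have hy : 0 < max l₁ l₂ := lt_max_of_lt_left hl₁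
  set y := max l₁ l₂
  refine RadialBound.of_flat hr (by positivity) (fun x hx => hx.1.n_pos) 0 (35 * (l₀ * y) ^ 3 / r)
    (4 * r) (by positivity) (by positivity) (by apply le_of_eq; field_simp; norm_num) ?_
  rintro ⟨n, m, Θ⟩ ⟨hc, hnm, hmr⟩
  simp only at hc hnm hmr ⊢
  refine ⟨hc.n_pos.le, by linarith, ?_⟩
  have h1 := hc.mul_sq_le hnm
  have h2 := hc.le_four_mul_min hnm hmr
  have key : (Θ * n) ^ 2 ≤ 1225 * l₀ ^ 6 * min n r := by
    have : 0 < l₀ ^ 6 := by positivity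
    have := hc.n_pos
    nlinarith
  calc (Θ / r * n) ^ 2 * y ^ 6 = (Θ * n) ^ 2 * (y ^ 6 / r ^ 2) := by ring
    _ ≤ 1225 * l₀ ^ 6 * min n r * (y ^ 6 / r ^ 2) := by gcongr
    _ = _ := by ring

lemma regionBounded_near_of_le_two (h12 : l₁ ≤ l₂) (h02 : l₀ ≤ l₂) :
    RegionBounded s₁ s₂ s₃ l₁ l₂ l₀ (fun n m r => n ≤ m ∧ m ≤ 4 * r)
      (200 * (l₂ * (l₁ * l₀)) ^ 2) := by
  refine .of_sub (l := l₂) h₁ h₂ h₃ hl₁ hl₂ hl₀ ⟨h12, le_rfl, h02⟩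
    (D := 140 * (l₂ * max l₁ l₀) ^ 3) (by positivity) ?_ fun m hm => ?_
  · rw [← min_mul_max l₁ l₀]
    exact six_mul_cube_le (lt_min hl₁ hl₀) min_le_max ((min_le_left _ _).trans h12)
  have hy : 0 < max l₁ l₀ := lt_max_of_lt_left hl₁
  set y := max l₁ l₀
  refine RadialBound.of_flat hm (by positivity) (fun x hx => hx.1.n_pos) 0 (140 * (l₂ * y) ^ 3 / m)
    m (by positivity) (by positivity) (by apply le_of_eq; field_simp) ?_
  rintro ⟨n, r, Θ⟩ ⟨hc, hnm, hmr⟩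
  simp only at hc hnm hmr ⊢
  refine ⟨hc.n_pos.le, by linarith, ?_⟩
  have h1 := hc.mul_sq_le hnm
  have hr := hc.r_pos
  have h2 : 1 / r ≤ 4 / m := by rw [div_le_div_iff₀ hr hm]; linarith
  have hΘ := hc.sq_nonneg
  have hn := hc.n_pos
  rw [min_eq_left hnm]
  calc (Θ / r * n) ^ 2 * y ^ 6 = (Θ * n) ^ 2 * ((1 / r) ^ 2 * y ^ 6) := by ring
    _ ≤ (300 * l₂ ^ 6 * n) * ((4 / m) ^ 2 * y ^ 6) := by gcongr
    _ = 4800 * (l₂ ^ 6 * n * (1 / m) ^ 2 * y ^ 6) := by ring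
    _ ≤ 19600 * (l₂ ^ 6 * n * (1 / m) ^ 2 * y ^ 6) := by gcongr; norm_num
    _ = _ := by ring

lemma regionBounded_near_low (h21 : l₂ ≤ l₁) (h01 : l₀ ≤ l₁) :
    RegionBounded s₁ s₂ s₃ l₁ l₂ l₀
      (fun n m r => (n ≤ m ∧ m ≤ 4 * r) ∧ n ≤ l₁ ^ 4 * max l₀ l₂ ^ 2)
      (200 * (l₁ * (l₀ * l₂)) ^ 2) := by
  have hy : 0 < max l₀ l₂ := lt_max_of_lt_left hl₀
  have hD := six_mul_four_two_le (lt_min hl₀ hl₂) min_le_max hl₁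
  rw [min_mul_max] at hD
  rcases le_total l₂ l₀ with h20 | h20
  · rw [min_eq_right h20] at hD
    refine .of_fst (l := l₁) h₁ h₂ h₃ hl₁ hl₂ hl₀ ⟨le_rfl, h21, h01⟩ (by positivity)
      (by rw [min_eq_right h21]; exact hD) fun r hr => ?_
    set y := max l₀ l₂
    refine RadialBound.of_trivial (fun x hx => hx.1.n_pos) 0 (10 * (l₁ ^ 4 * y ^ 2) / r)
      (4 * r) (by positivity) (by positivity) ?_ ?_
    · have : 0 < l₁ ^ 4 * y ^ 2 := by positivity
      field_simp; norm_num
    rintro ⟨n, m, Θ⟩ ⟨hc, ⟨hnm, hmr⟩, hn⟩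
    simp only at hc hnm hmr hn ⊢
    refine ⟨hc.n_pos.le, by linarith, ?_⟩
    rw [div_mul_eq_mul_div]
    have := hc.sq_le
    have := hc.n_pos
    gcongr
  · rw [min_eq_left h20] at hD
    refine .of_sub (l := l₁) h₁ h₂ h₃ hl₁ hl₂ hl₀ ⟨le_rfl, h21, h01⟩ (by positivity)
      (by rw [min_eq_right h01]; exact hD) fun m hm => ?_
    set y := max l₀ l₂
    refine RadialBound.of_trivial (fun x hx => hx.1.n_pos) 0 (40 * (l₁ ^ 4 * y ^ 2) / m)
      m (by positivity) (by positivity) ?_ ?_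
    · have : 0 < l₁ ^ 4 * y ^ 2 := by positivity
      field_simp; norm_num
    rintro ⟨n, r, Θ⟩ ⟨hc, ⟨hnm, hmr⟩, hn⟩
    simp only at hc hnm hmr hn ⊢
    refine ⟨hc.n_pos.le, by linarith, ?_⟩
    have hr := hc.r_pos
    have h2 : 1 / r ≤ 4 / m := by rw [div_le_div_iff₀ hr hm]; linarith
    have := hc.sq_le
    have := hc.n_pos
    calc Θ / r * n = Θ * n * (1 / r) := by ring
      _ ≤ 10 * (l₁ ^ 4 * y ^ 2) * (4 / m) := by gcongr
      _ = _ := by ring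

lemma regionBounded_near_wide (h21 : l₂ ≤ l₁) (h01 : l₀ ≤ l₁) :
    RegionBounded s₁ s₂ s₃ l₁ l₂ l₀
      (fun n m r => (n ≤ m ∧ m ≤ 4 * r) ∧ l₁ ^ 2 * n ≤ max l₀ l₂ ^ 2 * r)
      (200 * (l₁ * (l₀ * l₂)) ^ 2) := by
  have hy : 0 < max l₀ l₂ := lt_max_of_lt_left hl₀
  have hD := six_mul_four_two_le (lt_min hl₀ hl₂) min_le_max hl₁
  rw [min_mul_max] at hD
  rcases le_total l₂ l₀ with h20 | h20
  · rw [min_eq_right h20] at hD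
    refine .of_fst (l := l₁) h₁ h₂ h₃ hl₁ hl₂ hl₀ ⟨le_rfl, h21, h01⟩ (by positivity)
      (by rw [min_eq_right h21]; exact hD) fun r hr => ?_
    set y := max l₀ l₂
    refine RadialBound.of_trivial (fun x hx => hx.1.n_pos) 0 (30 * l₁ ^ 6 / r)
      (y ^ 2 * r / l₁ ^ 2) (by positivity) (by positivity) ?_ ?_
    · have : 0 < l₁ ^ 4 * y ^ 2 := by positivity
      field_simp; norm_num
    rintro ⟨n, m, Θ⟩ ⟨hc, ⟨hnm, hmr⟩, hn⟩
    simp only at hc hnm hmr hn ⊢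
    refine ⟨hc.n_pos.le, ?_, ?_⟩
    · rw [zero_add, le_div_iff₀ (by positivity)]; linarith
    rw [div_mul_eq_mul_div]
    have := hc.mul_le hnm
    gcongr
  · rw [min_eq_left h20] at hD
    refine .of_sub (l := l₁) h₁ h₂ h₃ hl₁ hl₂ hl₀ ⟨le_rfl, h21, h01⟩ (by positivity)
      (by rw [min_eq_right h01]; exact hD) fun m hm => ?_
    set y := max l₀ l₂
    refine RadialBound.of_trivial (fun x hx => hx.1.n_pos) 0 (120 * l₁ ^ 6 / m)
      (y ^ 2 * (2 * m) / l₁ ^ 2) (by positivity) (by positivity) ?_ ?_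
    · apply le_of_eq; field_simp; norm_num
    rintro ⟨n, r, Θ⟩ ⟨hc, ⟨hnm, hmr⟩, hn⟩
    simp only at hc hnm hmr hn ⊢
    have hr2 := hc.r_le
    refine ⟨hc.n_pos.le, ?_, ?_⟩
    · rw [zero_add, le_div_iff₀ (by positivity)]
      calc n * l₁ ^ 2 ≤ y ^ 2 * r := by linarith
        _ ≤ _ := by gcongr; linarith
    have hr := hc.r_pos
    have h2 : 1 / r ≤ 4 / m := by rw [div_le_div_iff₀ hr hm]; linarith
    have := hc.mul_le hnm
    calc Θ / r * n = Θ * n * (1 / r) := by ring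
      _ ≤ 30 * l₁ ^ 6 * (4 / m) := by gcongr
      _ = _ := by ring

lemma regionBounded_near_high (h21 : l₂ ≤ l₁) (h01 : l₀ ≤ l₁) :
    RegionBounded s₁ s₂ s₃ l₁ l₂ l₀
      (fun n m r => (n ≤ m ∧ m ≤ 4 * r) ∧ max l₀ l₂ ^ 2 * r ≤ l₁ ^ 2 * n ∧
        l₁ ^ 8 ≤ max l₀ l₂ ^ 2 * n)
      (200 * (l₁ * (l₀ * l₂)) ^ 2) := by
  have hy : 0 < max l₀ l₂ := lt_max_of_lt_left hl₀
  have hD := six_mul_four_two_le (lt_min hl₀ hl₂) min_le_max hl₁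
  rw [min_mul_max] at hD
  refine .of_snd (l := l₁) h₁ h₂ h₃ hl₁ hl₂ hl₀ ⟨le_rfl, h21, h01⟩ (by positivity) hD fun n hn => ?_
  set y := max l₀ l₂
  refine RadialBound.of_flat hn (by positivity) (fun x hx => hx.1.r_pos) 0
    (60 * (l₁ ^ 2 * y ^ 4) / n) (l₁ ^ 2 * n / y ^ 2) (by positivity) (by positivity) ?_ ?_
  · have : 0 < l₁ ^ 4 * y ^ 2 := by positivity
    field_simp; norm_num
  rintro ⟨m, r, Θ⟩ ⟨hc, ⟨hnm, hmr⟩, hr, hhigh⟩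
  simp only at hc hnm hmr hr hhigh ⊢
  have hrp := hc.r_pos
  refine ⟨hrp.le, ?_, ?_⟩
  · rw [zero_add, le_div_iff₀ (by positivity)]; linarith
  have h1 := hc.mul_le hnm
  have h2 := hc.le_four_mul_min hnm hmr
  have hΘ := hc.sq_nonneg
  rw [div_mul_cancel₀ _ hrp.ne', min_comm]
  calc Θ ^ 2 * y ^ 6 = (Θ * n) ^ 2 * y ^ 6 / n ^ 2 := by field_simp
    _ ≤ (30 * l₁ ^ 6) ^ 2 * y ^ 6 / n ^ 2 := by gcongr
    _ = 900 * l₁ ^ 4 * y ^ 6 / n ^ 2 * l₁ ^ 8 := by ring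
    _ ≤ 900 * l₁ ^ 4 * y ^ 6 / n ^ 2 * (y ^ 2 * (4 * min n r)) := by gcongr; exact hhigh.trans (by gcongr)
    _ = _ := by ring

lemma regionBounded_near_block (h21 : l₂ ≤ l₁) (h01 : l₀ ≤ l₁) {a : ℝ} (ha : 0 < a) :
    RegionBounded s₁ s₂ s₃ l₁ l₂ l₀
      (fun n m r => (n ≤ m ∧ m ≤ 4 * r) ∧ a ≤ n ∧ n ≤ a * (l₁ / max l₀ l₂))
      (400 * (l₁ * (l₀ * l₂)) ^ 2) := by
  have hy : 0 < max l₀ l₂ := lt_max_of_lt_left hl₀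
  have hD := six_mul_four_two_le (lt_min hl₀ hl₂) min_le_max hl₁
  rw [min_mul_max] at hD
  rw [show 400 * (l₁ * (l₀ * l₂)) ^ 2 = 2 * (200 * (l₁ * (l₀ * l₂)) ^ 2) by ring]
  refine .of_orthogonal (l := l₁) h₁ h₂ h₃ hl₁ hl₂ hl₀ ⟨le_rfl, h21, h01⟩ (by positivity) hD
    (N := a * (l₁ / max l₀ l₂)) (by positivity) (fun n m r h => h.2.2) fun s n hn => ?_
  set y := max l₀ l₂
  refine RadialBound.of_flat hn (by positivity) (fun x hx => hx.1.1.r_pos) s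
    (35 * (l₁ ^ 3 * y ^ 3) / a) (a * (l₁ / y)) (by positivity) (by positivity) ?_ ?_
  · have : 0 < l₁ ^ 4 * y ^ 2 := by positivity
    field_simp; norm_num
  rintro ⟨m, r, Θ⟩ ⟨⟨hc, ⟨hnm, hmr⟩, han, hna⟩, hs, hs'⟩
  simp only at hc hnm hmr han hna hs hs' ⊢
  have hrp := hc.r_pos
  refine ⟨hs, hs', ?_⟩
  have h1 := hc.mul_sq_le hnm
  have h2 := hc.le_four_mul_min hnm hmr
  have hΘ := hc.sq_nonneg
  rw [div_mul_cancel₀ _ hrp.ne', min_comm]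
  calc Θ ^ 2 * y ^ 6 = (Θ * n) ^ 2 * y ^ 6 / n ^ 2 := by field_simp
    _ ≤ (300 * l₁ ^ 6 * n) * y ^ 6 / a ^ 2 := by gcongr
    _ ≤ (300 * l₁ ^ 6 * (4 * min n r)) * y ^ 6 / a ^ 2 := by gcongr
    _ = 1200 * (l₁ ^ 6 * min n r * y ^ 6 / a ^ 2) := by ring
    _ ≤ 1225 * (l₁ ^ 6 * min n r * y ^ 6 / a ^ 2) := by
        have : 0 ≤ min n r := (lt_min hn hrp).le
        gcongr; norm_num
    _ = _ := by ring

end Pieces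

section Pieces

variable {s₁ s₂ s₃ l₁ l₂ l₀ : ℝ} (h₁ : s₁ = 1 ∨ s₁ = -1) (h₂ : s₂ = 1 ∨ s₂ = -1)
  (h₃ : s₃ = 1 ∨ s₃ = -1) (hl₁ : 0 < l₁) (hl₂ : 0 < l₂) (hl₀ : 0 < l₀)

include h₁ h₂ h₃ hl₁ hl₂ hl₀

lemma regionBounded_near_of_le_one (h21 : l₂ ≤ l₁) (h01 : l₀ ≤ l₁) :
    RegionBounded s₁ s₂ s₃ l₁ l₂ l₀ (fun n m r => n ≤ m ∧ m ≤ 4 * r)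
      (2200 * (l₁ * (l₀ * l₂)) ^ 2) := by
  have hy : 0 < max l₀ l₂ := lt_max_of_lt_left hl₀
  set y := max l₀ l₂ with hy_def
  set T := (l₁ * (l₀ * l₂)) ^ 2 with hT
  have hT0 : 0 ≤ T := by positivity
  have block : ∀ a : ℝ, 0 < a → RegionBounded s₁ s₂ s₃ l₁ l₂ l₀
      (fun n m r => (n ≤ m ∧ m ≤ 4 * r) ∧ a ≤ n ∧ n ≤ a * (l₁ / y)) (400 * T) := fun a ha =>
    regionBounded_near_block h₁ h₂ h₃ hl₁ hl₂ hl₀ h21 h01 ha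
  refine .split (fun n _ _ => n) (fun _ _ _ => l₁ ^ 4 * y ^ 2) (by fun_prop) (by fun_prop)
    (B₁ := 200 * T) (B₂ := 2000 * T) (by positivity) (by positivity) (by linarith)
    (regionBounded_near_low h₁ h₂ h₃ hl₁ hl₂ hl₀ h21 h01) ?_
  refine .split (fun n _ _ => l₁ ^ 2 * n) (fun _ _ r => y ^ 2 * r) (by fun_prop) (by fun_prop)
    (B₁ := 200 * T) (B₂ := 1800 * T) (by positivity) (by positivity) (by linarith)
    ((regionBounded_near_wide h₁ h₂ h₃ hl₁ hl₂ hl₀ h21 h01).mono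
      (fun n m r h => ⟨h.1.1, h.2⟩) le_rfl) ?_
  refine .split (fun n _ _ => n) (fun _ _ _ => l₁ ^ 4 * y ^ 2 * (l₁ / y)) (by fun_prop) (by fun_prop)
    (B₁ := 400 * T) (B₂ := 1400 * T) (by positivity) (by positivity) (by linarith)
    ((block _ (by positivity)).mono (fun n m r h => ⟨h.1.1.1, h.1.1.2, h.2⟩) le_rfl) ?_
  refine .split (fun n _ _ => n) (fun _ _ _ => l₁ ^ 4 * y ^ 2 * (l₁ / y) * (l₁ / y)) (by fun_prop)
    (by fun_prop) (B₁ := 400 * T) (B₂ := 1000 * T) (by positivity) (by positivity) (by linarith)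
    ((block _ (by positivity)).mono (fun n m r h => ⟨h.1.1.1.1, h.1.2, h.2⟩) le_rfl) ?_
  refine .split (fun n _ _ => n) (fun _ _ _ => l₁ ^ 4 * y ^ 2 * (l₁ / y) * (l₁ / y) * (l₁ / y))
    (by fun_prop) (by fun_prop) (B₁ := 400 * T) (B₂ := 600 * T) (by positivity) (by positivity)
    (by linarith)
    ((block _ (by positivity)).mono (fun n m r h => ⟨h.1.1.1.1.1, h.1.2, h.2⟩) le_rfl) ?_
  refine .split (fun n _ _ => n)
    (fun _ _ _ => l₁ ^ 4 * y ^ 2 * (l₁ / y) * (l₁ / y) * (l₁ / y) * (l₁ / y))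
    (by fun_prop) (by fun_prop) (B₁ := 400 * T) (B₂ := 200 * T) (by positivity) (by positivity)
    (by linarith)
    ((block _ (by positivity)).mono (fun n m r h => ⟨h.1.1.1.1.1.1, h.1.2, h.2⟩) le_rfl) ?_
  refine (regionBounded_near_high h₁ h₂ h₃ hl₁ hl₂ hl₀ h21 h01).mono
    (fun n m r h => ⟨h.1.1.1.1.1.1, h.1.1.1.1.2, ?_⟩) le_rfl
  have h8 := h.2
  calc l₁ ^ 8 = y ^ 2 * (l₁ ^ 4 * y ^ 2 * (l₁ / y) * (l₁ / y) * (l₁ / y) * (l₁ / y)) := by field_simp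
    _ ≤ y ^ 2 * n := by gcongr

lemma regionBounded_near :
    RegionBounded s₁ s₂ s₃ l₁ l₂ l₀ (fun n m r => n ≤ m ∧ m ≤ 4 * r)
      (2200 * (l₀ * l₁ * l₂) ^ 2) := by
  have hT : 0 ≤ (l₀ * l₁ * l₂) ^ 2 := by positivity
  rcases le_total l₂ l₁ with h21 | h12
  · rcases le_total l₀ l₁ with h01 | h10
    · exact (regionBounded_near_of_le_one h₁ h₂ h₃ hl₁ hl₂ hl₀ h21 h01).mono (fun _ _ _ h => h)
        (by nlinarith)
    · exact (regionBounded_near_of_le_zero h₁ h₂ h₃ hl₁ hl₂ hl₀ h10 (h21.trans h10)).mono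
        (fun _ _ _ h => h) (by nlinarith)
  · rcases le_total l₀ l₂ with h02 | h20
    · exact (regionBounded_near_of_le_two h₁ h₂ h₃ hl₁ hl₂ hl₀ h12 h02).mono (fun _ _ _ h => h)
        (by nlinarith)
    · exact (regionBounded_near_of_le_zero h₁ h₂ h₃ hl₁ hl₂ hl₀ (h12.trans h20) h20).mono
        (fun _ _ _ h => h) (by nlinarith)

omit h₁ h₂ h₃ hl₁ hl₂ hl₀ in
lemma AngleRelations.far {σ L n m r Θ : ℝ} (h : AngleRelations σ L n m r Θ)
    (hfar : 4 * r ≤ max n m) : 3 * r ≤ n ∧ 3 * r ≤ m ∧ n * 3 ≤ m * 4 ∧ Θ * n ≤ 40 * L := by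
  obtain ⟨hn, hm, hr, h1, h2, h3, h4, -, h5, -, -⟩ := h
  have h6 : 3 * r ≤ n ∧ 3 * r ≤ m ∧ n * 3 ≤ m * 4 ∧ n * 3 ≤ min n m * 4 := by
    rcases max_cases n m with ⟨h, _⟩ | ⟨h, _⟩ <;> rw [h] at hfar <;>
      rcases min_cases n m with ⟨h', _⟩ | ⟨h', _⟩ <;> rw [h'] <;>
      refine ⟨by linarith, by linarith, by linarith, by linarith⟩
  refine ⟨h6.1, h6.2.1, h6.2.2.1, ?_⟩
  nlinarith [mul_le_mul_of_nonneg_left h6.2.2.2 h4]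

lemma regionBounded_far_of_le_one (h21 : l₂ ≤ l₁) (h01 : l₀ ≤ l₁) :
    RegionBounded s₁ s₂ s₃ l₁ l₂ l₀ (fun n m r => 4 * r ≤ max n m)
      (200 * (l₁ * (l₀ * l₂)) ^ 2) := by
  have hy : 0 < max l₀ l₂ := lt_max_of_lt_left hl₀
  have hD := six_mul_cube_le (lt_min hl₀ hl₂) min_le_max ((min_le_left l₀ l₂).trans h01)
  rw [min_mul_max] at hD
  refine .of_snd (l := l₁) h₁ h₂ h₃ hl₁ hl₂ hl₀ ⟨le_rfl, h21, h01⟩ (by positivity) hD fun n hn => ?_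
  set y := max l₀ l₂
  refine RadialBound.of_sqrt hn (by positivity) (fun x hx => hx.1.r_pos)
    (20 * (l₁ * y) ^ 3 / √n) n (by positivity) (by positivity) ?_ ?_
  · rw [div_mul_cancel₀ _ (Real.sqrt_pos.2 hn).ne']
    gcongr; norm_num
  rintro ⟨m, r, Θ⟩ ⟨hc, hfar⟩
  simp only at hc hfar ⊢
  have hrp := hc.r_pos
  have hΘ := hc.sq_nonneg
  have hΘ10 := hc.sq_le
  obtain ⟨h1, -, -, h2⟩ := hc.far hfar
  refine ⟨by linarith, ?_⟩
  rw [div_mul_cancel₀ _ hrp.ne', min_eq_left (by linarith), div_pow, Real.sq_sqrt hn.le]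
  calc Θ ^ 2 * (r * y ^ 6) = Θ * (Θ * n) * (r * y ^ 6) / n := by field_simp
    _ ≤ 10 * (40 * l₁ ^ 6) * (r * y ^ 6) / n := by gcongr
    _ = _ := by ring

lemma regionBounded_far_parallel (h21 : l₂ ≤ l₁) (h10 : l₁ ≤ l₀) (hσ : s₁ * s₂ = 1) :
    RegionBounded s₁ s₂ s₃ l₁ l₂ l₀ (fun n m r => 4 * r ≤ max n m)
      (400 * (l₀ * (l₂ * l₁)) ^ 2) := by
  have hD := six_mul_four_two_le hl₂ h21 hl₀
  refine .split (fun _ _ r => l₀ ^ 2 * r) (fun n _ _ => l₁ ^ 2 * n) (by fun_prop) (by fun_prop)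
    (B₁ := 200 * (l₀ * (l₂ * l₁)) ^ 2) (B₂ := 200 * (l₀ * (l₂ * l₁)) ^ 2) (by positivity)
    (by positivity) (by linarith) ?_ ?_
  · refine .of_snd (l := l₀) h₁ h₂ h₃ hl₁ hl₂ hl₀ ⟨h10, h21.trans h10, le_rfl⟩ (by positivity)
      (by rw [min_eq_right (h21.trans h10)]; exact hD) fun n hn => ?_
    refine RadialBound.of_trivial (fun x hx => hx.1.r_pos) 0 (40 * l₀ ^ 6 / n)
      (l₁ ^ 2 * n / l₀ ^ 2) (by positivity) (by positivity) ?_ ?_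
    · have : 0 < l₀ ^ 4 * l₁ ^ 2 := by positivity
      field_simp; norm_num
    rintro ⟨m, r, Θ⟩ ⟨hc, hfar, hK⟩
    simp only at hc hfar hK ⊢
    have hrp := hc.r_pos
    obtain ⟨h1, -, -, h2⟩ := hc.far hfar
    refine ⟨hrp.le, ?_, ?_⟩
    · rw [zero_add, le_div_iff₀ (by positivity)]; linarith
    rwa [div_mul_cancel₀ _ hrp.ne', le_div_iff₀ hn]
  · refine .of_fst (l := l₀) h₁ h₂ h₃ hl₁ hl₂ hl₀ ⟨h10, h21.trans h10, le_rfl⟩ (by positivity)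
      (by rw [min_eq_right h21]; exact hD) fun r hr => ?_
    rw [max_eq_left h21]
    refine RadialBound.of_sqrt hr (by positivity) (fun x hx => hx.1.n_pos)
      (12 * (l₀ ^ 3 * l₁ ^ 3) / √r) ((l₀ / l₁) ^ 2 * r) (by positivity) (by positivity) ?_ ?_
    · rw [Real.sqrt_mul (by positivity), Real.sqrt_sq (by positivity)]
      have : 0 < √r := Real.sqrt_pos.2 hr
      have : 0 < l₀ ^ 4 * l₁ ^ 2 := by positivity
      field_simp; norm_num
    rintro ⟨n, m, Θ⟩ ⟨hc, hfar, hK⟩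
    simp only at hc hfar hK ⊢
    have hn := hc.n_pos
    have hΘ := hc.sq_nonneg
    obtain ⟨h1, -, h3, h2⟩ := hc.far hfar
    refine ⟨?_, ?_⟩
    · rw [div_pow, div_mul_eq_mul_div, le_div_iff₀ (by positivity)]; linarith
    rw [min_eq_right (by linarith), div_pow (12 * _), Real.sq_sqrt hr.le]
    have h4 : Θ * n * n ≤ 10 / 3 * r ^ 2 := by
      have := hc.sq_mul_mul_le hσ
      have := mul_le_mul_of_nonneg_left h3 (mul_nonneg hΘ hn.le)
      nlinarith
    calc (Θ / r * n) ^ 2 * (n * l₁ ^ 6) = Θ * n * n * (Θ * n) * (l₁ ^ 6 / r ^ 2) := by ring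
      _ ≤ 10 / 3 * r ^ 2 * (40 * l₀ ^ 6) * (l₁ ^ 6 / r ^ 2) := by gcongr
      _ = 400 / 3 * (l₀ ^ 6 * l₁ ^ 6) := by field_simp; norm_num
      _ ≤ 144 * (l₀ ^ 6 * l₁ ^ 6) := by gcongr; norm_num
      _ = _ := by field_simp; norm_num

lemma regionBounded_far_opposite (h21 : l₂ ≤ l₁) (h10 : l₁ ≤ l₀) (hσ : s₁ * s₂ = -1) :
    RegionBounded s₁ s₂ s₃ l₁ l₂ l₀ (fun n m r => 4 * r ≤ max n m)
      (400 * (l₀ * (l₂ * l₁)) ^ 2) := by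
  have hD := six_mul_four_two_le hl₂ h21 hl₀
  refine .split (fun _ _ r => r ^ 3) (fun n _ _ => n ^ 2 * l₁ ^ 6) (by fun_prop) (by fun_prop)
    (B₁ := 200 * (l₀ * (l₂ * l₁)) ^ 2) (B₂ := 200 * (l₀ * (l₂ * l₁)) ^ 2) (by positivity)
    (by positivity) (by linarith) ?_ ?_
  · refine .of_snd (l := l₀) h₁ h₂ h₃ hl₁ hl₂ hl₀ ⟨h10, h21.trans h10, le_rfl⟩ (by positivity)
      (by rw [min_eq_right (h21.trans h10)]; exact hD) fun n hn => ?_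
    refine RadialBound.of_trivial (fun x hx => hx.1.r_pos) 0 10
      (3 * (l₀ ^ 4 * l₁ ^ 2)) (by positivity) (by positivity) ?_ ?_
    · have : 0 < l₀ ^ 4 * l₁ ^ 2 := by positivity
      linarith
    rintro ⟨m, r, Θ⟩ ⟨hc, hfar, hK⟩
    simp only at hc hfar hK ⊢
    have hrp := hc.r_pos
    obtain ⟨h1, h1', -, h2⟩ := hc.far hfar
    have h4 : n ≤ 3 * l₀ ^ 6 := by linarith [hc.add_le hσ]
    refine ⟨hrp.le, ?_, ?_⟩
    · rw [zero_add]
      refine le_of_pow_le_pow_left₀ three_ne_zero (by positivity) (hK.trans ?_)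
      calc n ^ 2 * l₁ ^ 6 ≤ (3 * l₀ ^ 6) ^ 2 * l₁ ^ 6 := by gcongr
        _ = 9 * (l₀ ^ 12 * l₁ ^ 6) := by ring
        _ ≤ 27 * (l₀ ^ 12 * l₁ ^ 6) := by gcongr; norm_num
        _ = _ := by ring
    rw [div_mul_cancel₀ _ hrp.ne']
    exact hc.sq_le
  · refine .of_radial_fst h₂ hl₁ hl₂ (by positivity) (by rw [min_eq_right h21]; exact hD)
      fun q hr => ?_
    rw [max_eq_left h21]
    have hrel : ∀ p, (p, q) ∈ modulationSet s₁ s₂ s₃ (l₁ ^ 6) (l₂ ^ 6) (l₀ ^ 6) →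
        AngleRelations (s₁ * s₂) (l₀ ^ 6) ‖p.2‖ ‖(p - q).2‖ ‖q.2‖ (freqAngle s₁ s₂ p q ^ 2) := fun p hp =>
      .of_mem_pow h₁ h₂ h₃ hl₁ hl₂ hl₀ ⟨h10, h21.trans h10, le_rfl⟩ hp
    refine RadialBound.of_flat hr (by positivity) (fun p hp => hp.1.1.1)
      (-s₁ * q.1 / 2 - 3 / 2 * ‖q.2‖) (30 * (l₀ ^ 4 * l₁ ^ 2) / ‖q.2‖) (3 * ‖q.2‖)
      (by positivity) (by positivity) ?_ ?_
    · have : 0 < l₀ ^ 4 * l₁ ^ 2 := by positivity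
      field_simp; norm_num
    rintro p ⟨hp, hfar, hK⟩
    have hc := hrel p hp
    obtain ⟨-, hm1, hm2, -⟩ := hp
    have hl21 : l₂ ^ 6 ≤ l₁ ^ 6 := by gcongr
    simp only [Prod.fst_sub] at hm1 hm2
    generalize ‖p.2‖ = n at *
    generalize ‖(p - q).2‖ = m at *
    generalize ‖q.2‖ = r at *
    generalize freqAngle s₁ s₂ p q ^ 2 = Θ at *
    have hn := hc.n_pos
    have hΘ := hc.sq_nonneg
    obtain ⟨h3r, -, -, h2⟩ := hc.far hfar
    have hl1r : 9 * l₁ ^ 6 ≤ r := by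
      have h9 : 9 * r ^ 2 ≤ n ^ 2 := by nlinarith
      have h10 : r ^ 2 * (9 * l₁ ^ 6) ≤ r ^ 2 * r := by
        nlinarith [mul_le_mul_of_nonneg_right h9 (by positivity : 0 ≤ l₁ ^ 6)]
      exact le_of_mul_le_mul_left h10 (by positivity)
    have hwin : |n - (-s₁ * q.1 / 2)| ≤ 3 / 2 * r := by
      have ha := hc.n_le
      have hb := hc.m_le
      have hs₂ : s₂ = -s₁ := by rcases h₁ with rfl | rfl <;> linarith
      rw [hs₂] at hm2
      rw [abs_le] at hm1 hm2 ⊢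
      rcases h₁ with rfl | rfl <;> constructor <;> linarith [hm1.1, hm1.2, hm2.1, hm2.2]
    rw [abs_le] at hwin
    refine ⟨by linarith, by linarith, ?_⟩
    rw [min_eq_right (by linarith)]
    have key : (Θ * n) ^ 2 * l₁ ^ 6 ≤ 900 * (l₀ ^ 8 * l₁ ^ 4) * r := by
      refine le_of_pow_le_pow_left₀ three_ne_zero (by positivity) ?_
      calc ((Θ * n) ^ 2 * l₁ ^ 6) ^ 3 = (Θ * n) ^ 4 * (Θ ^ 2 * (n ^ 2 * l₁ ^ 6)) * l₁ ^ 12 := by ring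
        _ ≤ (40 * l₀ ^ 6) ^ 4 * (10 ^ 2 * r ^ 3) * l₁ ^ 12 := by gcongr; exact hc.sq_le
        _ = 256000000 * (l₀ ^ 24 * l₁ ^ 12 * r ^ 3) := by ring
        _ ≤ 729000000 * (l₀ ^ 24 * l₁ ^ 12 * r ^ 3) := by gcongr; norm_num
        _ = _ := by ring
    calc (Θ / r * n) ^ 2 * l₁ ^ 6 = (Θ * n) ^ 2 * l₁ ^ 6 / r ^ 2 := by ring
      _ ≤ 900 * (l₀ ^ 8 * l₁ ^ 4) * r / r ^ 2 := by gcongr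
      _ = _ := by ring

lemma regionBounded_far_of_le (h21 : l₂ ≤ l₁) :
    RegionBounded s₁ s₂ s₃ l₁ l₂ l₀ (fun n m r => 4 * r ≤ max n m)
      (400 * (l₀ * l₁ * l₂) ^ 2) := by
  have hT : 0 ≤ (l₀ * l₁ * l₂) ^ 2 := by positivity
  rcases le_total l₀ l₁ with h01 | h10
  · exact (regionBounded_far_of_le_one h₁ h₂ h₃ hl₁ hl₂ hl₀ h21 h01).mono (fun _ _ _ h => h)
      (by nlinarith)
  have hσ : s₁ * s₂ = 1 ∨ s₁ * s₂ = -1 := by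
    rcases h₁ with rfl | rfl <;> rcases h₂ with rfl | rfl <;> simp
  rcases hσ with hσ | hσ
  · exact (regionBounded_far_parallel h₁ h₂ h₃ hl₁ hl₂ hl₀ h21 h10 hσ).mono (fun _ _ _ h => h)
      (by nlinarith)
  · exact (regionBounded_far_opposite h₁ h₂ h₃ hl₁ hl₂ hl₀ h21 h10 hσ).mono (fun _ _ _ h => h)
      (by nlinarith)

theorem triBounded_angleKernel_modulationSet :
    TriBounded (angleKernel s₁ s₂ (modulationSet s₁ s₂ s₃ (l₁ ^ 6) (l₂ ^ 6) (l₀ ^ 6)))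
      (ENNReal.ofReal (5000 * (l₀ * l₁ * l₂) ^ 2)) := by
  have hT : 0 ≤ (l₀ * l₁ * l₂) ^ 2 := by positivity
  have h₃' : -s₃ = 1 ∨ -s₃ = -1 := by rcases h₃ with rfl | rfl <;> simp
  have main : RegionBounded s₁ s₂ s₃ l₁ l₂ l₀ (fun _ _ _ => True)
      (5000 * (l₀ * l₁ * l₂) ^ 2) := by
    refine .split (fun _ _ r => 4 * r) (fun n m _ => max n m) (by fun_prop) (by fun_prop)
      (B₁ := 400 * (l₀ * l₁ * l₂) ^ 2) (B₂ := 4400 * (l₀ * l₁ * l₂) ^ 2) (by positivity)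
      (by positivity) (by linarith) ?_ ?_
    · rcases le_total l₂ l₁ with h21 | h12
      · exact (regionBounded_far_of_le h₁ h₂ h₃ hl₁ hl₂ hl₀ h21).mono (fun _ _ _ h => h.2) le_rfl
      · refine RegionBounded.swap ((regionBounded_far_of_le h₂ h₁ h₃' hl₂ hl₁ hl₀ h12).mono
          (fun n m r h => ?_) (by nlinarith))
        rw [max_comm]; exact h.2
    · refine .split (fun n _ _ => n) (fun _ m _ => m) (by fun_prop) (by fun_prop)
        (B₁ := 2200 * (l₀ * l₁ * l₂) ^ 2) (B₂ := 2200 * (l₀ * l₁ * l₂) ^ 2) (by positivity)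
        (by positivity) (by linarith) ?_ ?_
      · exact (regionBounded_near h₁ h₂ h₃ hl₁ hl₂ hl₀).mono
          (fun n m r h => ⟨h.2, (le_max_right _ _).trans h.1.2⟩) le_rfl
      · exact RegionBounded.swap ((regionBounded_near h₂ h₁ h₃' hl₂ hl₁ hl₀).mono
          (fun n m r h => ⟨h.2, (le_max_left _ _).trans h.1.2⟩) (by nlinarith))
  exact main _ (measurableSet_modulationSet _ _ _ _ _ _) le_rfl fun _ _ => trivial

end Pieces

lemma lintegral_lintegral_tsum {T : ℕ → SpaceTime → SpaceTime → ENNReal}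
    (hT : ∀ k, Measurable (Function.uncurry (T k))) :
    ∫⁻ q, ∫⁻ p, ∑' k, T k p q = ∑' k, ∫⁻ q, ∫⁻ p, T k p q := by
  rw [← lintegral_tsum fun k => (Measurable.lintegral_prod_left
    (f := T k) (hT k)).aemeasurable]
  refine lintegral_congr fun q => ?_
  exact lintegral_tsum fun k => ((hT k).comp (measurable_id.prodMk measurable_const)).aemeasurable

lemma triForm_tsum_fst {K : SpaceTime → SpaceTime → ENNReal} {F : ℕ → SpaceTime → ENNReal}
    {G H : SpaceTime → ENNReal} (hK : Measurable (Function.uncurry K)) (hF : ∀ k, Measurable (F k))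
    (hG : Measurable G) (hH : Measurable H) :
    triForm K (fun p => ∑' k, F k p) G H = ∑' k, triForm K (F k) G H := by
  have hm := fun k => measurable_uncurry_triForm hK (hF k) hG hH
  unfold triForm
  rw [← lintegral_lintegral_tsum hm]
  refine lintegral_congr fun q => lintegral_congr fun p => ?_
  simp_rw [← ENNReal.tsum_mul_left, ← ENNReal.tsum_mul_right]

lemma triForm_tsum_snd {K : SpaceTime → SpaceTime → ENNReal} {G : ℕ → SpaceTime → ENNReal}
    {F H : SpaceTime → ENNReal} (hK : Measurable (Function.uncurry K)) (hF : Measurable F)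
    (hG : ∀ k, Measurable (G k)) (hH : Measurable H) :
    triForm K F (fun p => ∑' k, G k p) H = ∑' k, triForm K F (G k) H := by
  have hm := fun k => measurable_uncurry_triForm hK hF (hG k) hH
  unfold triForm
  rw [← lintegral_lintegral_tsum hm]
  refine lintegral_congr fun q => lintegral_congr fun p => ?_
  simp_rw [← ENNReal.tsum_mul_left, ← ENNReal.tsum_mul_right]

lemma triForm_tsum_thd {K : SpaceTime → SpaceTime → ENNReal} {H : ℕ → SpaceTime → ENNReal}
    {F G : SpaceTime → ENNReal} (hK : Measurable (Function.uncurry K)) (hF : Measurable F)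
    (hG : Measurable G) (hH : ∀ k, Measurable (H k)) :
    triForm K F G (fun p => ∑' k, H k p) = ∑' k, triForm K F G (H k) := by
  have hm := fun k => measurable_uncurry_triForm hK hF hG (hH k)
  unfold triForm
  rw [← lintegral_lintegral_tsum hm]
  refine lintegral_congr fun q => lintegral_congr fun p => ?_
  simp_rw [← ENNReal.tsum_mul_left]

/-- The localization of `F` to modulation `2 ^ k`. -/
def modPiece (φ : ℝ → ℝ) (s : ℝ) (F : SpaceTime → ENNReal) (k : ℕ) (p : SpaceTime) : ENNReal :=
  ENNReal.ofReal (lpPiece φ k (p.1 + s * ‖p.2‖)) * F p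

/-- The Besov-type norm `∑ 2^{k/3} ‖F_k‖` over the modulation localizations of `F`. -/
def besovNorm (φ : ℝ → ℝ) (s : ℝ) (F : SpaceTime → ENNReal) : ENNReal :=
  ∑' k : ℕ, ENNReal.ofReal ((2 : ℝ) ^ (1 / 3 * (k : ℝ))) * lnorm (modPiece φ s F k)

/-- Frequency pairs `(p, q)` such that `p`, `p - q`, `q` have nonzero spatial frequencies. -/
def nonzeroSet : Set (SpaceTime × SpaceTime) :=
  {z | 0 < ‖z.1.2‖ ∧ 0 < ‖(z.1 - z.2).2‖ ∧ 0 < ‖z.2.2‖}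

lemma measurableSet_nonzeroSet : MeasurableSet nonzeroSet := by
  unfold nonzeroSet
  measurability

namespace IsLPBump

variable {φ : ℝ → ℝ} (h : IsLPBump φ)
include h

lemma measurable_modPiece (s : ℝ) {F : SpaceTime → ENNReal} (hF : Measurable F) (k : ℕ) :
    Measurable (modPiece φ s F k) :=
  ((h.measurable_lpPiece k).comp
    (measurable_fst.add (measurable_snd.norm.const_mul s))).ennreal_ofReal.mul hF

lemma tsum_modPiece (s : ℝ) (F : SpaceTime → ENNReal) :
    (fun p => ∑' k, modPiece φ s F k p) = F := by
  funext p
  simp only [modPiece]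
  rw [ENNReal.tsum_mul_right, h.tsum_ofReal_lpPiece, one_mul]

lemma abs_le_of_modPiece_ne_zero {s : ℝ} {F : SpaceTime → ENNReal} {k : ℕ} {p : SpaceTime}
    (hp : modPiece φ s F k p ≠ 0) : |p.1 + s * ‖p.2‖| ≤ 2 * 2 ^ k :=
  h.abs_le_of_lpPiece_ne_zero fun h0 => hp (by simp [modPiece, h0])

lemma triForm_modPiece_le {s₁ s₂ s₃ : ℝ} (h₁ : s₁ = 1 ∨ s₁ = -1) (h₂ : s₂ = 1 ∨ s₂ = -1)
    (h₃ : s₃ = 1 ∨ s₃ = -1) {F G H : SpaceTime → ENNReal} (hF : Measurable F) (hG : Measurable G)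
    (hH : Measurable H) (i j k : ℕ) :
    triForm (angleKernel s₁ s₂ nonzeroSet) (modPiece φ s₁ F i) (modPiece φ s₂ G j)
        (modPiece φ s₃ H k) ≤
      ENNReal.ofReal 10000 *
        (ENNReal.ofReal ((2 : ℝ) ^ (1 / 3 * (i : ℝ))) * lnorm (modPiece φ s₁ F i)) *
        (ENNReal.ofReal ((2 : ℝ) ^ (1 / 3 * (j : ℝ))) * lnorm (modPiece φ s₂ G j)) *
        (ENNReal.ofReal ((2 : ℝ) ^ (1 / 3 * (k : ℝ))) * lnorm (modPiece φ s₃ H k)) := by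
  have hpow : ∀ n : ℕ, ((2 : ℝ) ^ (((n : ℝ) + 1) / 6)) ^ 6 = 2 * 2 ^ n := fun n => by
    rw [← Real.rpow_natCast, ← Real.rpow_mul (by norm_num), ← pow_succ', ← Real.rpow_natCast]
    push_cast
    ring_nf
  have hsq : ∀ n : ℕ, ((2 : ℝ) ^ (((n : ℝ) + 1) / 6)) ^ 2 =
      (2 : ℝ) ^ (1 / 3 : ℝ) * 2 ^ (1 / 3 * (n : ℝ)) := fun n => by
    rw [← Real.rpow_natCast, ← Real.rpow_mul (by norm_num), ← Real.rpow_add (by norm_num)]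
    push_cast
    ring_nf
  have htwo : ((2 : ℝ) ^ (1 / 3 : ℝ)) ^ 3 = 2 := by
    rw [← Real.rpow_natCast, ← Real.rpow_mul (by norm_num)]
    norm_num
  have key := triBounded_angleKernel_modulationSet h₁ h₂ h₃
    (l₁ := (2 : ℝ) ^ (((i : ℝ) + 1) / 6)) (l₂ := (2 : ℝ) ^ (((j : ℝ) + 1) / 6))
    (l₀ := (2 : ℝ) ^ (((k : ℝ) + 1) / 6)) (by positivity) (by positivity) (by positivity)
    _ _ _ (h.measurable_modPiece s₁ hF i) (h.measurable_modPiece s₂ hG j)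
    (h.measurable_modPiece s₃ hH k)
  rw [hpow, hpow, hpow, mul_pow, mul_pow, hsq, hsq, hsq,
    show ∀ a b c d : ℝ, 5000 * (d * c * (d * a) * (d * b)) = 5000 * d ^ 3 * a * b * c by
      intros; ring, htwo, ENNReal.ofReal_mul (by positivity), ENNReal.ofReal_mul (by positivity),
    ENNReal.ofReal_mul (by positivity)] at key
  refine le_trans (lintegral_mono fun q => lintegral_mono fun p => ?_) (key.trans_eq ?_)
  · by_cases hp : modPiece φ s₁ F i p = 0
    · simp [hp]
    by_cases hr : modPiece φ s₂ G j (p - q) = 0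
    · simp [hr]
    by_cases hq : modPiece φ s₃ H k q = 0
    · simp [hq]
    gcongr
    simp only [angleKernel]
    by_cases hz : (p, q) ∈ nonzeroSet
    · have hz' : (p, q) ∈ modulationSet s₁ s₂ s₃ (2 * 2 ^ i) (2 * 2 ^ j) (2 * 2 ^ k) :=
        ⟨hz, h.abs_le_of_modPiece_ne_zero hp, h.abs_le_of_modPiece_ne_zero hr,
          h.abs_le_of_modPiece_ne_zero hq⟩
      rw [Set.indicator_of_mem hz, Set.indicator_of_mem hz']
    · rw [Set.indicator_of_notMem hz]
      exact zero_le
  · rw [show (5000 : ℝ) * 2 = 10000 by norm_num]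
    ring

lemma triForm_le_besovNorm {s₁ s₂ s₃ : ℝ} (h₁ : s₁ = 1 ∨ s₁ = -1) (h₂ : s₂ = 1 ∨ s₂ = -1)
    (h₃ : s₃ = 1 ∨ s₃ = -1) {F G H : SpaceTime → ENNReal} (hF : Measurable F) (hG : Measurable G)
    (hH : Measurable H) :
    triForm (angleKernel s₁ s₂ nonzeroSet) F G H ≤
      ENNReal.ofReal 10000 * besovNorm φ s₁ F * besovNorm φ s₂ G * besovNorm φ s₃ H := by
  have hK := measurable_angleKernel s₁ s₂ measurableSet_nonzeroSet
  have hFm := h.measurable_modPiece s₁ hF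
  have hGm := h.measurable_modPiece s₂ hG
  have hHm := h.measurable_modPiece s₃ hH
  calc triForm (angleKernel s₁ s₂ nonzeroSet) F G H
      = ∑' i, triForm (angleKernel s₁ s₂ nonzeroSet) (modPiece φ s₁ F i) G H := by
        rw [← triForm_tsum_fst hK hFm hG hH, h.tsum_modPiece]
    _ = ∑' i, ∑' j, ∑' k, triForm (angleKernel s₁ s₂ nonzeroSet) (modPiece φ s₁ F i)
          (modPiece φ s₂ G j) (modPiece φ s₃ H k) := by
        refine tsum_congr fun i => ?_
        conv_lhs => rw [← h.tsum_modPiece s₂ G]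
        rw [triForm_tsum_snd hK (hFm i) hGm hH]
        refine tsum_congr fun j => ?_
        conv_lhs => rw [← h.tsum_modPiece s₃ H]
        rw [triForm_tsum_thd hK (hFm i) (hGm j) hHm]
    _ ≤ _ := ENNReal.tsum_le_tsum fun i => ENNReal.tsum_le_tsum fun j =>
        ENNReal.tsum_le_tsum fun k => h.triForm_modPiece_le h₁ h₂ h₃ hF hG hH i j k
    _ = _ := by simp_rw [ENNReal.tsum_mul_left, ENNReal.tsum_mul_right, ENNReal.tsum_mul_left,
      ENNReal.tsum_mul_right, ENNReal.tsum_mul_left, besovNorm]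

end IsLPBump

lemma one_le_jap (x : ℝ) : 1 ≤ jap x :=
  Real.one_le_sqrt.2 (by nlinarith [sq_nonneg x])

lemma jap_le_one_add {x : ℝ} (hx : 0 ≤ x) : jap x ≤ 1 + x :=
  Real.sqrt_le_iff.2 ⟨by linarith, by nlinarith⟩

lemma measurable_jap : Measurable jap := by
  unfold jap
  fun_prop

/-- The modulus of the weighted localization of `g` entering the Bourgain–Besov norm. -/
def weightedPiece (φ : ℝ → ℝ) (a s : ℝ) (g : SpaceTime → ℂ) (k : ℕ) (p : SpaceTime) : ℝ :=
  jap ‖p.2‖ ^ a * lpPiece φ k (p.1 + s * ‖p.2‖) * ‖g p‖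

namespace IsLPBump

variable {φ : ℝ → ℝ} (h : IsLPBump φ)
include h

lemma weightedPiece_nonneg (a s : ℝ) (g : SpaceTime → ℂ) (k : ℕ) (p : SpaceTime) :
    0 ≤ weightedPiece φ a s g k p :=
  mul_nonneg (mul_nonneg (Real.rpow_nonneg (Real.sqrt_nonneg _) _) (h.lpPiece_nonneg _ _))
    (norm_nonneg _)

lemma measurable_weightedPiece (a s : ℝ) {g : SpaceTime → ℂ} (hg : Measurable g) (k : ℕ) :
    Measurable (weightedPiece φ a s g k) :=
  (((measurable_jap.comp measurable_snd.norm).pow_const a).mul ((h.measurable_lpPiece k).comp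
    (measurable_fst.add (measurable_snd.norm.const_mul s)))).mul hg.norm

lemma lpPiece_le_weight {s : ℝ} (hs : s = 1 ∨ s = -1) (k : ℕ) (p : SpaceTime) :
    lpPiece φ k (p.1 + s * ‖p.2‖) ≤ 4 * (1 / 2) ^ k * (1 + ‖p‖) := by
  have hp := norm_nonneg p
  by_cases h0 : lpPiece φ k (p.1 + s * ‖p.2‖) = 0
  · rw [h0]; positivity
  refine (h.lpPiece_le_one _ _).trans ?_
  cases k with
  | zero => norm_num; linarith
  | succ k =>
    have hk := h.le_abs_of_lpPiece_ne_zero h0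
    have hsum : |p.1 + s * ‖p.2‖| ≤ 2 * ‖p‖ := by
      have h1 : |p.1| ≤ ‖p‖ := norm_fst_le p
      have h2 : |s * ‖p.2‖| ≤ ‖p‖ := by
        rw [abs_mul, abs_norm]
        rcases hs with rfl | rfl <;> simpa using norm_snd_le p
      linarith [abs_add_le p.1 (s * ‖p.2‖)]
    have h2k : (0 : ℝ) < 2 ^ k := by positivity
    rw [show 4 * (1 / 2 : ℝ) ^ (k + 1) * (1 + ‖p‖) = 2 * (1 + ‖p‖) / 2 ^ k by
      rw [one_div, inv_pow, pow_succ]; field_simp; norm_num, le_div_iff₀ h2k]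
    linarith

lemma exists_weightedPiece_le {a s : ℝ} (ha1 : a ≤ 1) (hs : s = 1 ∨ s = -1)
    (g : SchwartzMap SpaceTime ℂ) :
    ∃ D, 0 ≤ D ∧ ∀ k p, weightedPiece φ a s g k p ^ 2 ≤
      ((1 / 2) ^ k * D) ^ 2 * (1 + ‖p‖) ^ (-4 : ℝ) := by
  set C : ℝ := 2 ^ 4 * ((Finset.Iic (4, 0)).sup fun m => SchwartzMap.seminorm ℝ m.1 m.2) g
  have hC : ∀ p, (1 + ‖p‖) ^ 4 * ‖g p‖ ≤ C := fun p => by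
    simpa using SchwartzMap.one_add_le_sup_seminorm_apply (𝕜 := ℝ) (m := (4, 0)) le_rfl le_rfl g p
  have hC0 : 0 ≤ C := le_trans (by positivity) (hC 0)
  refine ⟨4 * C, by positivity, fun k p => ?_⟩
  have hp := norm_nonneg p
  have hj : jap ‖p.2‖ ^ a ≤ 1 + ‖p‖ :=
    calc jap ‖p.2‖ ^ a ≤ jap ‖p.2‖ ^ (1 : ℝ) := Real.rpow_le_rpow_of_exponent_le (one_le_jap _) ha1
      _ = jap ‖p.2‖ := Real.rpow_one _
      _ ≤ 1 + ‖p.2‖ := jap_le_one_add (norm_nonneg _)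
      _ ≤ 1 + ‖p‖ := by gcongr; exact norm_snd_le p
  have hle : weightedPiece φ a s g k p * (1 + ‖p‖) ^ 2 ≤ (1 / 2) ^ k * (4 * C) :=
    calc weightedPiece φ a s g k p * (1 + ‖p‖) ^ 2
        ≤ (1 + ‖p‖) * (4 * (1 / 2) ^ k * (1 + ‖p‖)) * ‖g p‖ * (1 + ‖p‖) ^ 2 := by
          unfold weightedPiece
          gcongr
          · exact h.lpPiece_nonneg _ _
          · exact h.lpPiece_le_weight hs k p
      _ = (1 / 2) ^ k * (4 * ((1 + ‖p‖) ^ 4 * ‖g p‖)) := by ring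
      _ ≤ _ := by gcongr; exact hC p
  rw [Real.rpow_neg (by positivity), ← div_eq_mul_inv, le_div_iff₀ (by positivity),
    show (4 : ℝ) = (4 : ℕ) by norm_num, Real.rpow_natCast,
    show weightedPiece φ a s g k p ^ 2 * (1 + ‖p‖) ^ 4 =
      (weightedPiece φ a s g k p * (1 + ‖p‖) ^ 2) ^ 2 by ring]
  have := h.weightedPiece_nonneg a s g k p
  exact_mod_cast pow_le_pow_left₀ (by positivity) hle 2

lemma integrable_weightedPiece_sq {a s : ℝ} (ha1 : a ≤ 1) (hs : s = 1 ∨ s = -1)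
    (g : SchwartzMap SpaceTime ℂ) (k : ℕ) :
    Integrable fun p => weightedPiece φ a s g k p ^ 2 := by
  obtain ⟨D, -, hD⟩ := h.exists_weightedPiece_le ha1 hs g
  have hI : Integrable fun p : SpaceTime => (1 + ‖p‖) ^ (-4 : ℝ) :=
    integrable_one_add_norm (by simp [SpaceTime]; norm_num)
  refine (hI.const_mul (((1 / 2) ^ k * D) ^ 2)).mono'
    ((h.measurable_weightedPiece a s g.continuous.measurable k).pow_const 2).aestronglyMeasurable
    (Filter.Eventually.of_forall fun p => ?_)
  rw [Real.norm_of_nonneg (sq_nonneg _)]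
  exact hD k p

variable {f g : SchwartzMap SpaceTime ℂ} (hfg : ∀ τ ξ, ftST (fun p => f p) τ ξ = g (τ, ξ))
include hfg

lemma l2F_eq_sqrt_integral {a s : ℝ} (ha1 : a ≤ 1) (hs : s = 1 ∨ s = -1) (k : ℕ) :
    (l2F fun τ ξ => ((jap ‖ξ‖ ^ a * lpPiece φ k (τ + s * ‖ξ‖) : ℝ) : ℂ) *
      ftST (fun p => f p) τ ξ) = √(∫ p, weightedPiece φ a s g k p ^ 2) := by
  have hI := h.integrable_weightedPiece_sq ha1 hs g k
  rw [l2F]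
  refine congrArg Real.sqrt (Eq.trans ?_ (integral_prod _ hI).symm)
  refine integral_congr_ae (Filter.Eventually.of_forall fun τ => ?_)
  refine integral_congr_ae (Filter.Eventually.of_forall fun ξ => ?_)
  have h0 : 0 ≤ jap ‖ξ‖ ^ a * lpPiece φ k (τ + s * ‖ξ‖) :=
    mul_nonneg (Real.rpow_nonneg (Real.sqrt_nonneg _) _) (h.lpPiece_nonneg _ _)
  simp only [hfg, norm_mul, Complex.norm_real, Real.norm_of_nonneg h0, weightedPiece]

lemma ofReal_l2F {a s : ℝ} (ha1 : a ≤ 1) (hs : s = 1 ∨ s = -1) (k : ℕ) :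
    ENNReal.ofReal (l2F fun τ ξ => ((jap ‖ξ‖ ^ a * lpPiece φ k (τ + s * ‖ξ‖) : ℝ) : ℂ) *
      ftST (fun p => f p) τ ξ) = lnorm fun p => ENNReal.ofReal (weightedPiece φ a s g k p) := by
  rw [h.l2F_eq_sqrt_integral hfg ha1 hs, Real.sqrt_eq_rpow,
    ← ENNReal.ofReal_rpow_of_nonneg (integral_nonneg fun _ => sq_nonneg _) (by norm_num),
    ofReal_integral_eq_lintegral_ofReal (h.integrable_weightedPiece_sq ha1 hs g k)
      (Filter.Eventually.of_forall fun _ => sq_nonneg _), lnorm]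
  simp_rw [ENNReal.ofReal_pow (h.weightedPiece_nonneg a s g k _)]

lemma summable_XnormB {a b s : ℝ} (ha1 : a ≤ 1) (hb : b < 1)
    (hs : s = 1 ∨ s = -1) :
    Summable fun k : ℕ => (2 : ℝ) ^ (b * k) *
      l2F fun τ ξ => ((jap ‖ξ‖ ^ a * lpPiece φ k (τ + s * ‖ξ‖) : ℝ) : ℂ) *
        ftST (fun p => f p) τ ξ := by
  obtain ⟨D, hD0, hD⟩ := h.exists_weightedPiece_le ha1 hs g
  have hI : Integrable fun p : SpaceTime => (1 + ‖p‖) ^ (-4 : ℝ) :=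
    integrable_one_add_norm (by simp [SpaceTime]; norm_num)
  have hr : (2 : ℝ) ^ b * (1 / 2) < 1 := by
    have := Real.rpow_lt_rpow_of_exponent_lt (one_lt_two (α := ℝ)) hb
    rw [Real.rpow_one] at this
    linarith
  have hgeom := (summable_geometric_of_lt_one (by positivity) hr).mul_right
    (D * √(∫ p : SpaceTime, (1 + ‖p‖) ^ (-4 : ℝ)))
  refine Summable.of_nonneg_of_le (fun k => mul_nonneg (by positivity) (Real.sqrt_nonneg _))
    (fun k => ?_) hgeom
  rw [h.l2F_eq_sqrt_integral hfg ha1 hs, mul_pow, Real.rpow_mul (by norm_num),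
    Real.rpow_natCast, mul_assoc]
  gcongr
  calc √(∫ p, weightedPiece φ a s g k p ^ 2)
      ≤ √(((1 / 2) ^ k * D) ^ 2 * ∫ p : SpaceTime, (1 + ‖p‖) ^ (-4 : ℝ)) := by
        gcongr
        rw [← integral_const_mul]
        exact integral_mono (h.integrable_weightedPiece_sq ha1 hs g k) (hI.const_mul _) (hD k)
    _ = _ := by
        rw [Real.sqrt_mul (sq_nonneg _), Real.sqrt_sq (by positivity), mul_assoc]

lemma ofReal_XnormB {a b s : ℝ} (ha1 : a ≤ 1) (hb : b < 1) (hs : s = 1 ∨ s = -1) :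
    ENNReal.ofReal (XnormB φ a b s fun p => f p) = ∑' k : ℕ, ENNReal.ofReal ((2 : ℝ) ^ (b * k)) *
      lnorm fun p => ENNReal.ofReal (weightedPiece φ a s g k p) := by
  rw [XnormB, ENNReal.ofReal_tsum_of_nonneg
    (fun k => mul_nonneg (by positivity) (by exact Real.sqrt_nonneg _))
    (h.summable_XnormB hfg ha1 hb hs)]
  refine tsum_congr fun k => ?_
  rw [ENNReal.ofReal_mul (by positivity), h.ofReal_l2F hfg ha1 hs]

lemma besovNorm_le_XnormB {a s : ℝ} (ha1 : a ≤ 1) (hs : s = 1 ∨ s = -1)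
    {w : SpaceTime → ℝ} (hw : ∀ p, w p ≤ jap ‖p.2‖ ^ a) :
    besovNorm φ s (fun p => ENNReal.ofReal (w p * ‖g p‖)) ≤
      ENNReal.ofReal (XnormB φ a (1 / 3) s fun p => f p) := by
  rw [h.ofReal_XnormB hfg ha1 (by norm_num) hs, besovNorm]
  refine ENNReal.tsum_le_tsum fun k => ?_
  unfold lnorm
  gcongr with p
  rw [modPiece, ← ENNReal.ofReal_mul (h.lpPiece_nonneg _ _)]
  refine ENNReal.ofReal_le_ofReal ?_
  rw [weightedPiece, mul_comm (jap _ ^ a), mul_assoc]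
  exact mul_le_mul_of_nonneg_left (mul_le_mul_of_nonneg_right (hw p) (norm_nonneg _))
    (h.lpPiece_nonneg _ _)

end IsLPBump

lemma ae_snd_ne_zero : ∀ᵐ q : SpaceTime, q.2 ≠ 0 :=
  Measure.quasiMeasurePreserving_snd.ae (Measure.ae_ne (volume : Measure E2) 0)

lemma lintegral_freqAngle_eq_triForm (s₁ s₂ : ℝ) (F G H : SpaceTime → ENNReal) :
    ∫⁻ q, ∫⁻ p, ENNReal.ofReal (freqAngle s₁ s₂ p q) * F p * G (p - q) * H q =
      triForm (angleKernel s₁ s₂ nonzeroSet) F G fun q => ENNReal.ofReal √‖q.2‖ * H q := by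
  refine lintegral_congr_ae (ae_snd_ne_zero.mono fun q hq => lintegral_congr fun p => ?_)
  have hs : √‖q.2‖ ≠ 0 := (Real.sqrt_pos.2 (norm_pos_iff.2 hq)).ne'
  simp only [angleKernel]
  by_cases hz : (p, q) ∈ nonzeroSet
  · rw [Set.indicator_of_mem hz]
    conv_lhs => rw [← div_mul_cancel₀ (freqAngle s₁ s₂ p q) hs,
      ENNReal.ofReal_mul' (Real.sqrt_nonneg _)]
    ring
  · have h0 : freqAngle s₁ s₂ p q = 0 := by
      by_contra hne
      refine hz ⟨norm_pos_iff.2 fun hp => hne ?_, norm_pos_iff.2 fun hp => hne ?_,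
        norm_pos_iff.2 hq⟩
      · simp [freqAngle, angOrZero, show p.2 = 0 from hp]
      · simp [freqAngle, angOrZero, show p.2 - q.2 = 0 from hp]
    rw [Set.indicator_of_notMem hz, h0]
    simp

/-- An iterated integral is at most the iterated lower Lebesgue integral of the modulus. -/
lemma ofReal_iterated_integral_le {f : SpaceTime → SpaceTime → ℝ} (hf0 : ∀ p q, 0 ≤ f p q)
    (hf : Measurable (Function.uncurry f)) :
    ENNReal.ofReal (∫ τ : ℝ, ∫ ξ : E2, ∫ lam : ℝ, ∫ η : E2, f (lam, η) (τ, ξ)) ≤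
      ∫⁻ q, ∫⁻ p, ENNReal.ofReal (f p q) := by
  have hm : Measurable (Function.uncurry fun p q => ENNReal.ofReal (f p q)) := hf.ennreal_ofReal
  refine (Real.ofReal_le_enorm _).trans ((enorm_integral_le_lintegral_enorm _).trans ?_)
  refine le_trans ?_ (lintegral_prod _ (Measurable.lintegral_prod_left hm).aemeasurable).symm.le
  refine lintegral_mono fun τ => (enorm_integral_le_lintegral_enorm _).trans ?_
  refine lintegral_mono fun ξ => (enorm_integral_le_lintegral_enorm _).trans ?_
  refine le_trans ?_ (lintegral_prod _
    (hm.comp (measurable_id.prodMk measurable_const)).aemeasurable).symm.le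
  refine lintegral_mono fun lam => (enorm_integral_le_lintegral_enorm _).trans ?_
  refine lintegral_mono fun η => ?_
  exact (Real.enorm_of_nonneg (hf0 _ _)).le

/-- Angle-weighted convolution estimate:
    ∫∫∫∫ ∠(s₁η, s₂(η−ξ)) |ψ̃(λ,η)| |ψ̃′(λ−τ,η−ξ)| |φ̃₀(τ,ξ)| dλ dη dτ dξ ≤
    c ‖ψ‖_{X^{0,1/3,1}_{s₁}} ‖ψ′‖_{X^{0,1/3,1}_{s₂}} ‖φ₀‖_{X^{1/2,1/3,1}_{s₃}}. -/
theorem angle_weighted_trilinear_estimate :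
    ∀ φ : ℝ → ℝ, IsLPBump φ →
      ∃ c : ℝ, 0 < c ∧
        ∀ s₁ s₂ s₃ : ℝ, (s₁ = 1 ∨ s₁ = -1) → (s₂ = 1 ∨ s₂ = -1) → (s₃ = 1 ∨ s₃ = -1) →
          ∀ ψ ψ' φ₀ : SchwartzMap SpaceTime ℂ,
            (∫ τ : ℝ, ∫ ξ : E2, ∫ lam : ℝ, ∫ η : E2,
                angOrZero (s₁ • η) (s₂ • (η - ξ)) * ‖ftST (fun p => ψ p) lam η‖ *
                  ‖ftST (fun p => ψ' p) (lam - τ) (η - ξ)‖ * ‖ftST (fun p => φ₀ p) τ ξ‖) ≤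
              c * XnormB φ 0 (1 / 3) s₁ (fun p => ψ p) *
                XnormB φ 0 (1 / 3) s₂ (fun p => ψ' p) *
                  XnormB φ (1 / 2) (1 / 3) s₃ (fun p => φ₀ p) := by
  intro φ h
  refine ⟨10000, by norm_num, fun s₁ s₂ s₃ h₁ h₂ h₃ ψ ψ' φ₀ => ?_⟩
  obtain ⟨F, hF⟩ := exists_schwartz_eq_ftST ψ
  obtain ⟨G, hG⟩ := exists_schwartz_eq_ftST ψ'
  obtain ⟨H, hH⟩ := exists_schwartz_eq_ftST φ₀
  have hFm := F.continuous.measurable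
  have hGm := G.continuous.measurable
  have hHm := H.continuous.measurable
  have hX : ∀ a s f, 0 ≤ XnormB φ a (1 / 3) s f := fun a s f =>
    tsum_nonneg fun k => mul_nonneg (by positivity) (Real.sqrt_nonneg _)
  simp only [hF, hG, hH]
  refine (ENNReal.ofReal_le_ofReal_iff (mul_nonneg (mul_nonneg (mul_nonneg (by norm_num)
    (hX _ _ _)) (hX _ _ _)) (hX _ _ _))).1 ?_
  refine (ofReal_iterated_integral_le
    (f := fun p q => freqAngle s₁ s₂ p q * ‖F p‖ * ‖G (p - q)‖ * ‖H q‖)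
    (fun p q => mul_nonneg (mul_nonneg (mul_nonneg (angOrZero_nonneg _ _) (norm_nonneg _))
      (norm_nonneg _)) (norm_nonneg _)) ?_).trans ?_
  · exact (((measurable_freqAngle s₁ s₂).mul (hFm.comp measurable_fst).norm).mul
      (hGm.comp (measurable_fst.sub measurable_snd)).norm).mul (hHm.comp measurable_snd).norm
  simp_rw [ENNReal.ofReal_mul' (norm_nonneg _)]
  rw [lintegral_freqAngle_eq_triForm s₁ s₂ (fun p => ENNReal.ofReal ‖F p‖)
    (fun p => ENNReal.ofReal ‖G p‖) fun p => ENNReal.ofReal ‖H p‖]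
  simp_rw [← ENNReal.ofReal_mul (Real.sqrt_nonneg _)]
  refine (h.triForm_le_besovNorm h₁ h₂ h₃ hFm.norm.ennreal_ofReal hGm.norm.ennreal_ofReal
    (by fun_prop)).trans ?_
  rw [ENNReal.ofReal_mul' (hX _ _ _), ENNReal.ofReal_mul' (hX _ _ _),
    ENNReal.ofReal_mul' (hX _ _ _)]
  gcongr
  · simpa using h.besovNorm_le_XnormB hF (a := 0) zero_le_one h₁ (w := fun _ => 1) (by simp)
  · simpa using h.besovNorm_le_XnormB hG (a := 0) zero_le_one h₂ (w := fun _ => 1) (by simp)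
  · refine h.besovNorm_le_XnormB hH (by norm_num) h₃ fun p => ?_
    rw [← Real.sqrt_eq_rpow]
    exact Real.sqrt_le_sqrt (Real.le_sqrt_of_sq_le (by linarith))
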